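/- arXiv:2302.02451 — 3 statements merged into one kernel-verified Lean document; each statement's English description precedes it below -/
import Mathlib

section
/- Let X ∈ ℝ^{n×q} and Y ∈ ℝ^{n×d} be nonzero matrices with rows x_i and y_i respectively, let γ := ‖X‖_op²/‖Y‖_op², and let {p_i}_{i∈[n]} be a probability distribution on [n] satisfying p_i ≥ (1/4)·(‖x_i‖₂² + γ‖y_i‖₂²)/(‖X‖_F² + γ‖Y‖_F²) for all i ∈ [n]. Let ℓ₁, …, ℓ_m ∈ [n] be i.i.d. samples from {p_i} and let Π ∈ ℝ^{m×n} be the random sampling matrix whose r-th row is (1/√(m·p_{ℓ_r}))·e_{ℓ_r}ᵀ. Then for every ε > 0, Pr[‖XᵀΠᵀΠY − XᵀY‖_op > ε‖X‖_op‖Y‖_op] ≤ (q+d)·exp(−3mε² / (8(3+ε)(srank(X) + srank(Y)))). -/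
/-- The spectral (operator) norm of a real matrix. -/
noncomputable def opNorm {m n : ℕ} (M : Matrix (Fin m) (Fin n) ℝ) : ℝ :=
  ‖LinearMap.toContinuousLinearMap (Matrix.toEuclideanLin M)‖

/-- The Frobenius norm of a real matrix. -/
noncomputable def frobNorm {m n : ℕ} (M : Matrix (Fin m) (Fin n) ℝ) : ℝ :=
  Real.sqrt (∑ i, ∑ j, (M i j) ^ 2)

/-- The stable rank ‖M‖_F² / ‖M‖_op². -/
noncomputable def srank {m n : ℕ} (M : Matrix (Fin m) (Fin n) ℝ) : ℝ :=
  frobNorm M ^ 2 / opNorm M ^ 2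

/-- The sampling matrix Π ∈ ℝ^{m×n} built from indices ℓ₁,…,ℓ_m: its r-th row is
(1/√(m·p_{ℓ_r}))·e_{ℓ_r}ᵀ. -/
noncomputable def samplingMatrix {n : ℕ} (m : ℕ) (p : Fin n → ℝ) (ℓ : Fin m → Fin n) :
    Matrix (Fin m) (Fin n) ℝ :=
  Matrix.of fun r i => if i = ℓ r then (Real.sqrt (m * p (ℓ r)))⁻¹ else 0


open NormedSpace Filter Topology

theorem amm_scalar_exp (x c : ℝ) (hx : x ≤ c) (hc0 : 0 ≤ c) (hc : c < 3) :
    Real.exp x ≤ 1 + x + (x^2/2) / (1 - c/3) := by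
  have h1 : 0 < 1 - c/3 := by linarith
  rcases le_total x 0 with h | h
  · have h2 := Real.quadratic_le_exp_of_nonneg (x := -x) (by linarith)
    have h3 : Real.exp x * Real.exp (-x) = 1 := by rw [← Real.exp_add]; simp
    have h4 : Real.exp x ≤ 1 + x + x^2/2 := by
      have h5 : 0 < 1 + -x + (-x)^2/2 := by nlinarith
      have h6 : Real.exp x * (1 + -x + (-x)^2/2) ≤ 1 := by
        refine le_trans ?_ h3.le; exact mul_le_mul_of_nonneg_left h2 (Real.exp_pos x).le
      have h7 : 1 ≤ (1 + x + x^2/2) * (1 + -x + (-x)^2/2) := by nlinarith [sq_nonneg (x^2)]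
      exact le_of_mul_le_mul_right (h6.trans h7) h5
    have h8 : x^2/2 ≤ (x^2/2) / (1 - c/3) := by
      rw [le_div_iff₀ h1]; nlinarith [sq_nonneg x]
    linarith
  · have hmono : MonotoneOn (fun x : ℝ => (x^2+4*x+6) * Real.exp (-x) + 2*x - 6) (Set.Ici 0) := by
      have hd : ∀ y : ℝ, HasDerivAt (fun x : ℝ => (x^2+4*x+6) * Real.exp (-x) + 2*x - 6)
          (2 - (y^2+2*y+2) * Real.exp (-y)) y := by
        intro y
        have e1 : HasDerivAt (fun x : ℝ => x^2+4*x+6) (2*y+4) y := by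
          have := (((hasDerivAt_id y).pow 2).add ((hasDerivAt_id y).const_mul 4)).add_const 6
          exact this.congr_deriv (by simp)
        have e2 : HasDerivAt (fun x : ℝ => Real.exp (-x)) (-Real.exp (-y)) y := by
          have := (hasDerivAt_neg y).exp
          exact this.congr_deriv (by ring)
        have := ((e1.mul e2).add ((hasDerivAt_id y).const_mul 2)).sub_const 6
        exact this.congr_deriv (by ring)
      apply monotoneOn_of_deriv_nonneg (convex_Ici 0)
      · exact fun y _ => (hd y).continuousAt.continuousWithinAt
      · exact fun y _ => (hd y).differentiableAt.differentiableWithinAt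
      · intro y hy
        rw [(hd y).deriv]
        simp at hy
        have := Real.quadratic_le_exp_of_nonneg hy.le
        have h3 : Real.exp y * Real.exp (-y) = 1 := by rw [← Real.exp_add]; simp
        nlinarith [Real.exp_pos (-y)]
    have := hmono (Set.mem_Ici.2 le_rfl) (Set.mem_Ici.2 h) h
    simp at this
    have h3 : Real.exp x * Real.exp (-x) = 1 := by rw [← Real.exp_add]; simp
    have h4 : Real.exp x * (6 - 2*x) ≤ x^2+4*x+6 := by
      have : 6 - 2*x ≤ (x^2+4*x+6) * Real.exp (-x) := by linarith
      have := mul_le_mul_of_nonneg_left this (Real.exp_pos x).le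
      nlinarith
    have h5 : Real.exp x - 1 - x ≤ (x^2/2) / (1 - x/3) := by
      rw [le_div_iff₀ (by linarith)]; nlinarith
    have h6 : (x^2/2) / (1 - x/3) ≤ (x^2/2) / (1 - c/3) := by
      apply div_le_div_of_nonneg_left (by positivity) h1; linarith
    linarith

section trotter
variable {𝔸 : Type*} [NormedRing 𝔸] [NormedAlgebra ℝ 𝔸] [CompleteSpace 𝔸] [NormOneClass 𝔸]

theorem amm_norm_exp_le (x : 𝔸) : ‖exp x‖ ≤ Real.exp ‖x‖ := by
  rw [Real.exp_eq_exp_ℝ, exp_eq_tsum ℝ, exp_eq_tsum ℝ]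
  refine tsum_of_norm_bounded (f := fun n : ℕ => ((n.factorial : ℝ)⁻¹) • x^n) (g := fun n : ℕ => ((n.factorial : ℝ)⁻¹) • ‖x‖^n) ?_ ?_
  · exact (expSeries_summable' (𝕂 := ℝ) ‖x‖).hasSum
  · intro n
    rw [norm_smul, smul_eq_mul]
    gcongr
    · simp
    · exact norm_pow_le x n

theorem amm_pow_sub_pow_le (x y : 𝔸) (M : ℝ) (hM : 1 ≤ M) (hx : ‖x‖ ≤ M) (hy : ‖y‖ ≤ M) (n : ℕ) :
    ‖x^n - y^n‖ ≤ n * ‖x - y‖ * M^n := by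
  have hM0 : 0 ≤ M := by linarith
  induction n with
  | zero => simp
  | succ n ih =>
    have : x^(n+1) - y^(n+1) = x * (x^n - y^n) + (x - y) * y^n := by
      rw [pow_succ', pow_succ']; noncomm_ring
    rw [this]
    calc _ ≤ ‖x * (x^n-y^n)‖ + ‖(x-y)*y^n‖ := norm_add_le _ _
      _ ≤ M * (n * ‖x - y‖ * M^n) + ‖x-y‖ * M^n := by
        gcongr
        · exact (norm_mul_le _ _).trans (by gcongr)
        · refine (norm_mul_le _ _).trans ?_
          gcongr
          exact (norm_pow_le _ _).trans (by gcongr)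
      _ ≤ M * (n * ‖x - y‖ * M^n) + ‖x-y‖ * M^(n+1) := by
        gcongr
        omega
      _ = _ := by push_cast; ring

theorem amm_trotter (A B : 𝔸) :
    Tendsto (fun N : ℕ => (exp (((N:ℝ)+1)⁻¹ • A) * exp (((N:ℝ)+1)⁻¹ • B))^(N+1)) atTop
      (𝓝 (exp (A + B))) := by
  let _ : NormedAlgebra ℚ 𝔸 := NormedAlgebra.restrictScalars ℚ ℝ 𝔸
  have hf : HasDerivAt (fun t : ℝ => exp (t • A) * exp (t • B) - exp (t • (A+B))) 0 0 := by
    have h1 := hasDerivAt_exp_smul_const (𝕂 := ℝ) A (0:ℝ)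
    have h2 := hasDerivAt_exp_smul_const (𝕂 := ℝ) B (0:ℝ)
    have h3 := hasDerivAt_exp_smul_const (𝕂 := ℝ) (A+B) (0:ℝ)
    have := (h1.mul h2).sub h3
    exact this.congr_deriv (by simp)
  have hlim : Tendsto (fun N : ℕ => ((N:ℝ)+1) * ‖exp (((N:ℝ)+1)⁻¹ • A) * exp (((N:ℝ)+1)⁻¹ • B)
      - exp (((N:ℝ)+1)⁻¹ • (A+B))‖) atTop (𝓝 0) := by
    have h4 := hf.tendsto_slope_zero
    have h5 : Tendsto (fun N : ℕ => ((N:ℝ)+1)⁻¹) atTop (𝓝[≠] 0) := by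
      apply tendsto_nhdsWithin_iff.2 ⟨?_, ?_⟩
      · simpa using tendsto_one_div_add_atTop_nhds_zero_nat (𝕜 := ℝ)
      · exact Eventually.of_forall fun N => by
          have : (0:ℝ) < (N:ℝ)+1 := by positivity
          simp [this.ne']
    have h6 := (h4.comp h5).norm
    simp only [norm_zero] at h6
    refine h6.congr fun N => ?_
    have : (0:ℝ) < (N:ℝ)+1 := by positivity
    simp [norm_smul, abs_of_pos this]
  rw [tendsto_iff_norm_sub_tendsto_zero]
  have hz : Tendsto (fun N : ℕ => ((N:ℝ)+1) * ‖exp (((N:ℝ)+1)⁻¹ • A) * exp (((N:ℝ)+1)⁻¹ • B)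
      - exp (((N:ℝ)+1)⁻¹ • (A+B))‖ * Real.exp (‖A‖ + ‖B‖)) atTop (𝓝 0) := by
    simpa using hlim.mul_const (Real.exp (‖A‖ + ‖B‖))
  refine squeeze_zero (fun _ => norm_nonneg _) (fun N => ?_) hz
  have hN : (0:ℝ) < (N:ℝ)+1 := by positivity
  have hpow : exp (A+B) = (exp (((N:ℝ)+1)⁻¹ • (A+B)))^(N+1) := by
    rw [← NormedSpace.exp_nsmul, ← Nat.cast_smul_eq_nsmul ℝ, smul_smul]
    push_cast
    rw [mul_inv_cancel₀ hN.ne', one_smul]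
  have hn : ∀ C : 𝔸, ‖((N:ℝ)+1)⁻¹ • C‖ = ((N:ℝ)+1)⁻¹ * ‖C‖ := by
    intro C; rw [norm_smul, Real.norm_of_nonneg (by positivity)]
  have key := amm_pow_sub_pow_le (exp (((N:ℝ)+1)⁻¹ • A) * exp (((N:ℝ)+1)⁻¹ • B))
    (exp (((N:ℝ)+1)⁻¹ • (A+B))) (Real.exp (((N:ℝ)+1)⁻¹ * (‖A‖+‖B‖)))
    (Real.one_le_exp (by positivity)) (by
      refine (norm_mul_le _ _).trans ?_
      rw [mul_add, Real.exp_add, ← hn, ← hn]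
      gcongr <;> exact amm_norm_exp_le _) (by
      refine (amm_norm_exp_le _).trans ?_
      rw [hn]
      gcongr
      exact norm_add_le _ _) (N+1)
  rw [← hpow, ← Real.exp_nat_mul] at key
  refine key.trans (le_of_eq ?_)
  push_cast
  rw [mul_inv_cancel_left₀ hN.ne']
end trotter

section gt
variable {ι : Type*} [Fintype ι] [DecidableEq ι]
open Matrix

theorem amm_trace_mul_le (C D : Matrix ι ι ℝ) :
    (C * D).trace ≤ ((C * Cᵀ).trace + (Dᵀ * D).trace) / 2 := by
  simp only [Matrix.trace, Matrix.diag, Matrix.mul_apply, Matrix.transpose_apply]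
  have : ∑ x, ∑ j, D j x * D j x = ∑ x, ∑ j, D x j * D x j := Finset.sum_comm
  rw [Finset.sum_comm (f := fun x j => D j x * D j x)] 
  rw [Finset.sum_comm (f := fun j x => D j x * D j x), ← Finset.sum_add_distrib, Finset.sum_div]
  refine Finset.sum_le_sum fun i _ => ?_
  rw [← Finset.sum_add_distrib, Finset.sum_div]
  refine Finset.sum_le_sum fun j _ => ?_
  nlinarith [sq_nonneg (C i j - D j i)]

theorem amm_trace_pow_comm (A B : Matrix ι ι ℝ) (k : ℕ) :
    ((A * B)^k).trace = ((B * A)^k).trace := by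
  cases k with
  | zero => simp
  | succ k =>
    have : (A * B)^(k+1) = A * ((B * A)^k * B) := by
      induction k with
      | zero => simp
      | succ k ih => rw [pow_succ', ih, pow_succ' (B*A) k]; simp only [Matrix.mul_assoc]
    rw [this, Matrix.trace_mul_comm, Matrix.mul_assoc, ← pow_succ]

theorem amm_trace_pow_aux (k : ℕ) :
    (∀ M : Matrix ι ι ℝ, (M^(2^(k+1))).trace ≤ ((Mᵀ * M)^(2^k)).trace) ∧
    (∀ C D : Matrix ι ι ℝ, Cᵀ = C → Dᵀ = D →
      ((C * D)^(2^k)).trace ≤ ((C^(2^(k+1))).trace + (D^(2^(k+1))).trace)/2) := by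
  induction k with
  | zero =>
    constructor
    · intro M
      have := amm_trace_mul_le M M
      simp only [zero_add, pow_one, pow_zero, pow_two]
      rw [Matrix.trace_mul_comm M Mᵀ] at this
      linarith
    · intro C D hC hD
      have := amm_trace_mul_le C D
      simpa [pow_two, hC, hD] using this
  | succ k ih =>
    obtain ⟨hU, hT⟩ := ih
    constructor
    · intro M
      have h1 := hU (M^2)
      rw [← pow_mul, ← pow_succ'] at h1
      refine h1.trans ?_
      have h2 : (M^2)ᵀ * M^2 = Mᵀ * (Mᵀ * M * M) := by
        rw [pow_two, Matrix.transpose_mul]; simp only [Matrix.mul_assoc]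
      rw [h2, amm_trace_pow_comm]
      have h3 : Mᵀ * M * M * Mᵀ = (Mᵀ * M) * (M * Mᵀ) := by simp only [Matrix.mul_assoc]
      rw [h3]
      refine (hT _ _ (by simp) (by simp)).trans ?_
      rw [amm_trace_pow_comm M Mᵀ]
      linarith
    · intro C D hC hD
      refine (hU (C*D)).trans ?_
      have h2 : (C*D)ᵀ * (C * D) = D * (C * C * D) := by
        rw [Matrix.transpose_mul, hC, hD]; simp only [Matrix.mul_assoc]
      rw [h2, amm_trace_pow_comm]
      have h3 : C * C * D * D = C^2 * D^2 := by simp only [pow_two, Matrix.mul_assoc]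
      rw [h3]
      refine (hT _ _ (by rw [Matrix.transpose_pow, hC]) (by rw [Matrix.transpose_pow, hD])).trans ?_
      rw [← pow_mul, ← pow_mul, ← pow_succ']

theorem amm_gt_aux (k : ℕ) : ∀ P Q : Matrix ι ι ℝ, Pᵀ = P → Qᵀ = Q → 
    ((P * Q)^(2^k)).trace ≤ (P^(2^k) * Q^(2^k)).trace := by
  induction k with
  | zero => intro P Q _ _; simp
  | succ k ih =>
    intro C D hC hD
    refine ((amm_trace_pow_aux k).1 (C*D)).trans ?_
    have h2 : (C*D)ᵀ * (C * D) = D * (C * C * D) := by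
      rw [Matrix.transpose_mul, hC, hD]; simp only [Matrix.mul_assoc]
    rw [h2, amm_trace_pow_comm]
    have h3 : C * C * D * D = C^2 * D^2 := by simp only [pow_two, Matrix.mul_assoc]
    rw [h3]
    refine (ih _ _ (by rw [Matrix.transpose_pow, hC]) (by rw [Matrix.transpose_pow, hD])).trans ?_
    rw [← pow_mul, ← pow_mul, ← pow_succ']

theorem amm_trotter_matrix [Nonempty ι] (A B : Matrix ι ι ℝ) :
    Tendsto (fun N : ℕ => (exp (((N:ℝ)+1)⁻¹ • A) * exp (((N:ℝ)+1)⁻¹ • B))^(N+1)) atTop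
      (𝓝 (exp (A + B))) := 
  open scoped Matrix.Norms.Operator in amm_trotter A B

theorem amm_golden_thompson [Nonempty ι] (A B : Matrix ι ι ℝ) (hA : Aᵀ = A) (hB : Bᵀ = B) :
    (exp (A+B)).trace ≤ (exp A * exp B).trace := by
  have h1 := amm_trotter_matrix A B
  have h2 : Tendsto (fun k : ℕ => 2^k - 1) atTop atTop := by
    apply tendsto_atTop_mono (f := fun k => k)
    · intro k; have := Nat.lt_two_pow_self (n := k); omega
    · exact tendsto_id
  have hc : Continuous (fun M : Matrix ι ι ℝ => M.trace) := continuous_id.matrix_trace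
  have h3 := (hc.tendsto _).comp (h1.comp h2)
  refine le_of_tendsto' h3 fun k => ?_
  have hk : 2^k - 1 + 1 = 2^k := Nat.sub_add_cancel Nat.one_le_two_pow
  simp only [Function.comp]
  rw [hk]
  have hk' : (((2^k - 1 : ℕ) : ℝ) + 1) = ((2^k : ℕ) : ℝ) := by
    rw [← hk]; push_cast; simp
  rw [hk']
  have h0 : ((2^k : ℕ) : ℝ) ≠ 0 := by positivity
  refine (amm_gt_aux k _ _ ?_ ?_).trans (le_of_eq ?_)
  · rw [← Matrix.exp_transpose, Matrix.transpose_smul, hA]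
  · rw [← Matrix.exp_transpose, Matrix.transpose_smul, hB]
  · have : ∀ C : Matrix ι ι ℝ, (exp (((2^k : ℕ) : ℝ)⁻¹ • C))^(2^k) = exp C := by
      intro C
      rw [← Matrix.exp_nsmul, ← Nat.cast_smul_eq_nsmul ℝ, smul_smul, mul_inv_cancel₀ h0, one_smul]
    rw [this, this]
end gt
section bern
variable {ι : Type*} [Fintype ι] [DecidableEq ι]
open Matrix

theorem amm_spec (H : Matrix ι ι ℝ) (hH : Hᵀ = H) : ∃ (U : Matrix ι ι ℝ) (lam : ι → ℝ),
    U * Uᵀ = 1 ∧ Uᵀ * U = 1 ∧ H = U * diagonal lam * Uᵀ ∧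
    ∀ t : ℝ, exp (t • H) = U * diagonal (fun i => Real.exp (t * lam i)) * Uᵀ := by
  have hh : H.IsHermitian := by
    rw [Matrix.IsHermitian, Matrix.conjTranspose_eq_transpose_of_trivial, hH]
  have e0 : star (hh.eigenvectorUnitary : Matrix ι ι ℝ) = (hh.eigenvectorUnitary : Matrix ι ι ℝ)ᵀ := by
    rw [Matrix.star_eq_conjTranspose, Matrix.conjTranspose_eq_transpose_of_trivial]
  have e1 : (hh.eigenvectorUnitary : Matrix ι ι ℝ) * (hh.eigenvectorUnitary : Matrix ι ι ℝ)ᵀ = 1 := by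
    rw [← e0]; exact Unitary.coe_mul_star_self _
  have e2 : (hh.eigenvectorUnitary : Matrix ι ι ℝ)ᵀ * (hh.eigenvectorUnitary : Matrix ι ι ℝ) = 1 := by
    rw [← e0]; exact Unitary.coe_star_mul_self _
  have e3 : H = (hh.eigenvectorUnitary : Matrix ι ι ℝ) * diagonal hh.eigenvalues *
      (hh.eigenvectorUnitary : Matrix ι ι ℝ)ᵀ := by
    have := hh.spectral_theorem
    rw [Unitary.conjStarAlgAut_apply] at this
    rw [← e0]
    exact this
  generalize (hh.eigenvectorUnitary : Matrix ι ι ℝ) = U at *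
  generalize hh.eigenvalues = lam at *
  refine ⟨U, lam, e1, e2, e3, fun t => ?_⟩
  have hinv : U⁻¹ = Uᵀ := Matrix.inv_eq_right_inv e1
  have hu : IsUnit U := ⟨⟨U, Uᵀ, e1, e2⟩, rfl⟩
  have h1 : t • H = U * diagonal (fun i => t * lam i) * U⁻¹ := by
    rw [hinv, e3]
    have : diagonal (fun i => t * lam i) = t • diagonal lam := by
      rw [← Matrix.diagonal_smul]; rfl
    rw [this]; simp
  rw [h1, Matrix.exp_conj _ _ hu, hinv, Matrix.exp_diagonal, Pi.exp_def]
  simp only [Real.exp_eq_exp_ℝ]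

theorem amm_quad (U : Matrix ι ι ℝ) (f : ι → ℝ) (w : ι → ℝ) :
    w ⬝ᵥ (U * diagonal f * Uᵀ) *ᵥ w = ∑ i, f i * (Uᵀ *ᵥ w) i ^ 2 := by
  rw [← Matrix.mulVec_mulVec, ← Matrix.mulVec_mulVec, Matrix.dotProduct_mulVec,
    ← Matrix.mulVec_transpose]
  simp only [dotProduct, Matrix.mulVec_diagonal]
  exact Finset.sum_congr rfl fun i _ => by ring

theorem amm_quad_one (U : Matrix ι ι ℝ) (hU : U * Uᵀ = 1) (w : ι → ℝ) :
    w ⬝ᵥ w = ∑ i, (Uᵀ *ᵥ w) i ^ 2 := by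
  have := amm_quad U (fun _ => 1) w
  simpa [hU] using this

theorem amm_quad_sq (U : Matrix ι ι ℝ) (hU : Uᵀ * U = 1) (f : ι → ℝ) (w : ι → ℝ) :
    ((U * diagonal f * Uᵀ) *ᵥ w) ⬝ᵥ ((U * diagonal f * Uᵀ) *ᵥ w)
      = ∑ i, f i ^ 2 * (Uᵀ *ᵥ w) i ^ 2 := by
  rw [← amm_quad U (fun i => f i ^ 2) w]
  rw [Matrix.dotProduct_mulVec, ← Matrix.mulVec_transpose, Matrix.mulVec_mulVec, dotProduct_comm]
  congr 2
  rw [Matrix.transpose_mul, Matrix.transpose_mul, Matrix.transpose_transpose, Matrix.diagonal_transpose]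
  calc U * (diagonal f * Uᵀ) * (U * diagonal f * Uᵀ)
      = U * (diagonal f * (Uᵀ * U) * diagonal f) * Uᵀ := by simp only [Matrix.mul_assoc]
    _ = _ := by rw [hU, Matrix.mul_one, Matrix.diagonal_mul_diagonal]; simp only [pow_two]

theorem amm_eig_le (U : Matrix ι ι ℝ) (hU : Uᵀ * U = 1) (f : ι → ℝ) (hU' : U * Uᵀ = 1) (L : ℝ)
    (h : ∀ w : ι → ℝ, w ⬝ᵥ (U * diagonal f * Uᵀ) *ᵥ w ≤ L * (w ⬝ᵥ w)) (i : ι) : f i ≤ L := by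
  have := h (U *ᵥ Pi.single i 1)
  rw [amm_quad, amm_quad_one U hU', Matrix.mulVec_mulVec, hU, Matrix.one_mulVec] at this
  simpa [Pi.single_apply] using this

theorem amm_mgf (H : Matrix ι ι ℝ) (hH : Hᵀ = H) (L θ : ℝ) (hL : 0 ≤ L) (hθ : 0 ≤ θ) (hθL : θ * L < 3)
    (h : ∀ w : ι → ℝ, w ⬝ᵥ H *ᵥ w ≤ L * (w ⬝ᵥ w)) (w : ι → ℝ) :
    w ⬝ᵥ exp (θ • H) *ᵥ w ≤ w ⬝ᵥ w + θ * (w ⬝ᵥ H *ᵥ w) +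
      ((θ^2/2) / (1 - θ*L/3)) * ((H *ᵥ w) ⬝ᵥ (H *ᵥ w)) := by
  obtain ⟨U, lam, h1, h2, h3, h4⟩ := amm_spec H hH
  rw [h4]
  subst h3
  have h5 := amm_eig_le U h2 lam h1 L h
  rw [amm_quad, amm_quad, amm_quad_one U h1, amm_quad_sq U h2, Finset.mul_sum, Finset.mul_sum,
    ← Finset.sum_add_distrib, ← Finset.sum_add_distrib]
  refine Finset.sum_le_sum fun i _ => ?_
  have := amm_scalar_exp (θ * lam i) (θ * L) (mul_le_mul_of_nonneg_left (h5 i) hθ) (by positivity) hθL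
  have := mul_le_mul_of_nonneg_right this (sq_nonneg ((Uᵀ *ᵥ w) i))
  refine this.trans (le_of_eq ?_)
  ring

theorem amm_trace_exp_ge (H : Matrix ι ι ℝ) (hH : Hᵀ = H) (t θ : ℝ) (hθ : 0 ≤ θ) (w : ι → ℝ)
    (h : t * (w ⬝ᵥ w) < w ⬝ᵥ H *ᵥ w) : Real.exp (θ * t) ≤ (exp (θ • H)).trace := by
  obtain ⟨U, lam, h1, h2, h3, h4⟩ := amm_spec H hH
  rw [h4]
  subst h3
  have h5 : ∃ i, t < lam i := by
    by_contra! hcon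
    rw [amm_quad, amm_quad_one U h1, Finset.mul_sum] at h
    exact absurd h (not_lt.2 (Finset.sum_le_sum fun i _ =>
      mul_le_mul_of_nonneg_right (hcon i) (sq_nonneg _)))
  obtain ⟨i, hi⟩ := h5
  rw [Matrix.trace_mul_comm, ← Matrix.mul_assoc, h2, Matrix.one_mul, Matrix.trace_diagonal]
  calc Real.exp (θ * t) ≤ Real.exp (θ * lam i) := by gcongr
    _ ≤ _ := Finset.single_le_sum (f := fun i => Real.exp (θ * lam i))
      (fun j _ => (Real.exp_pos _).le) (Finset.mem_univ i)

theorem amm_trace_exp_mul (S M : Matrix ι ι ℝ) (hS : Sᵀ = S) :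
    (exp S * M).trace = ∑ k, (exp ((1/2:ℝ) • S) k) ⬝ᵥ M *ᵥ (exp ((1/2:ℝ) • S) k) := by
  have h1 : exp S = exp ((1/2:ℝ) • S) * exp ((1/2:ℝ) • S) := by
    rw [← Matrix.exp_add_of_commute _ _ (Commute.refl _), ← add_smul]; norm_num
  have h2 : (exp ((1/2:ℝ) • S))ᵀ = exp ((1/2:ℝ) • S) := by
    rw [← Matrix.exp_transpose, Matrix.transpose_smul, hS]
  rw [h1, Matrix.mul_assoc, Matrix.trace_mul_comm]
  generalize exp ((1/2:ℝ) • S) = R at *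
  have h3 : R * M * R = R * (M * Rᵀ) := by rw [h2, Matrix.mul_assoc]
  rw [h3, Matrix.trace]
  refine Finset.sum_congr rfl fun k _ => ?_
  simp only [Matrix.diag, Matrix.mul_apply, dotProduct, mulVec, Matrix.transpose_apply]

theorem amm_trace_exp_nonneg (S : Matrix ι ι ℝ) (hS : Sᵀ = S) : 0 ≤ (exp S).trace := by
  have := amm_trace_exp_mul S 1 hS
  rw [Matrix.mul_one] at this
  rw [this]
  refine Finset.sum_nonneg fun k _ => ?_
  rw [Matrix.one_mulVec]
  exact Finset.sum_nonneg fun j _ => mul_self_nonneg _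

theorem amm_prod_bound [Nonempty ι] {n : ℕ} (p : Fin n → ℝ) (hp0 : ∀ i, 0 ≤ p i)
    (H : Fin n → Matrix ι ι ℝ) (hH : ∀ i, (H i)ᵀ = H i) (c : ℝ) (hc : 0 ≤ c)
    (h : ∀ w : ι → ℝ, ∑ i, p i * (w ⬝ᵥ exp (H i) *ᵥ w) ≤ c * (w ⬝ᵥ w)) (m : ℕ) :
    ∑ ℓ : Fin m → Fin n, (∏ r, p (ℓ r)) * (exp (∑ r, H (ℓ r))).trace ≤ c^m * Fintype.card ι := by
  induction m with
  | zero => simp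
  | succ m ih =>
    have hsymm : ∀ ℓ : Fin m → Fin n, (∑ r, H (ℓ r))ᵀ = ∑ r, H (ℓ r) := by
      intro ℓ; rw [Matrix.transpose_sum]; simp only [hH]
    rw [← (Fin.consEquiv (fun _ : Fin (m+1) => Fin n)).sum_comp, Fintype.sum_prod_type_right]
    have step : ∀ ℓ : Fin m → Fin n, ∑ i, p i * (exp (H i + ∑ r, H (ℓ r))).trace
        ≤ c * (exp (∑ r, H (ℓ r))).trace := by
      intro ℓ
      have hs := hsymm ℓ
      generalize (∑ r, H (ℓ r)) = S at *
      calc ∑ i, p i * (exp (H i + S)).trace ≤ ∑ i, p i * (exp S * exp (H i)).trace := by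
            refine Finset.sum_le_sum fun i _ => mul_le_mul_of_nonneg_left ?_ (hp0 i)
            rw [add_comm]
            exact amm_golden_thompson _ _ hs (hH i)
        _ = ∑ k, ∑ i, p i * ((exp ((1/2:ℝ) • S) k) ⬝ᵥ exp (H i) *ᵥ (exp ((1/2:ℝ) • S) k)) := by
            rw [Finset.sum_comm]
            refine Finset.sum_congr rfl fun i _ => ?_
            rw [amm_trace_exp_mul _ _ hs, Finset.mul_sum]
        _ ≤ ∑ k, c * ((exp ((1/2:ℝ) • S) k) ⬝ᵥ (exp ((1/2:ℝ) • S) k)) :=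
            Finset.sum_le_sum fun k _ => h _
        _ = c * (exp S).trace := by
            have := amm_trace_exp_mul S 1 hs
            simp only [Matrix.mul_one, Matrix.one_mulVec] at this
            rw [this, Finset.mul_sum]
    calc _ = ∑ ℓ : Fin m → Fin n, (∏ r, p (ℓ r)) * ∑ i, p i * (exp (H i + ∑ r, H (ℓ r))).trace := by
          refine Finset.sum_congr rfl fun ℓ _ => ?_
          rw [Finset.mul_sum]
          refine Finset.sum_congr rfl fun i _ => ?_
          simp only [Fin.consEquiv_apply, Fin.prod_univ_succ, Fin.sum_univ_succ, Fin.cons_zero, Fin.cons_succ]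
          ring
      _ ≤ ∑ ℓ : Fin m → Fin n, (∏ r, p (ℓ r)) * (c * (exp (∑ r, H (ℓ r))).trace) := by
          refine Finset.sum_le_sum fun ℓ _ => mul_le_mul_of_nonneg_left (step ℓ) ?_
          exact Finset.prod_nonneg fun r _ => hp0 _
      _ = c * ∑ ℓ : Fin m → Fin n, (∏ r, p (ℓ r)) * (exp (∑ r, H (ℓ r))).trace := by
          rw [Finset.mul_sum]
          exact Finset.sum_congr rfl fun ℓ _ => by ring
      _ ≤ c * (c^m * Fintype.card ι) := mul_le_mul_of_nonneg_left ih hc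
      _ = _ := by ring

open Classical in
theorem amm_bernstein [Nonempty ι] {n m : ℕ} (p : Fin n → ℝ) (hp0 : ∀ i, 0 ≤ p i)
    (hp1 : ∑ i, p i = 1)
    (Z : Fin n → Matrix ι ι ℝ) (hZ : ∀ i, (Z i)ᵀ = Z i) (s : ℝ) (hs : 0 < s)
    (hmean : ∀ w : ι → ℝ, ∑ i, p i * (w ⬝ᵥ Z i *ᵥ w) = 0)
    (hvar : ∀ w : ι → ℝ, ∑ i, p i * ((Z i *ᵥ w) ⬝ᵥ (Z i *ᵥ w)) ≤ 4 * s * (w ⬝ᵥ w))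
    (hmax : ∀ i, ∀ w : ι → ℝ, w ⬝ᵥ Z i *ᵥ w ≤ 4 * s * (w ⬝ᵥ w))
    (ε : ℝ) (hε : 0 < ε) (E : (Fin m → Fin n) → Prop)
    (hE : ∀ ℓ, E ℓ → (∀ r, p (ℓ r) ≠ 0) → ∃ w : ι → ℝ, (m * ε) * (w ⬝ᵥ w) < w ⬝ᵥ (∑ r, Z (ℓ r)) *ᵥ w) :
    (∑ ℓ : Fin m → Fin n, if E ℓ then ∏ r, p (ℓ r) else 0) ≤
      (Fintype.card ι : ℝ) * Real.exp (-(3 * m * ε ^ 2) / (8 * (3 + ε) * s)) := by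
  set θ : ℝ := 3 * ε / (4 * s * (3 + ε)) with hθdef
  have hθ : 0 < θ := by positivity
  have hθL : θ * (4 * s) / 3 = ε / (3 + ε) := by rw [hθdef]; field_simp
  have hθL3 : θ * (4*s) < 3 := by
    have : ε / (3+ε) < 1 := by rw [div_lt_one (by positivity)]; linarith
    linarith
  set g : ℝ := (θ^2/2) / (1 - θ*(4*s)/3) with hg
  have hg0 : 0 ≤ g := by
    rw [hg]; apply div_nonneg (by positivity); linarith
  have hgs : g * (4 * s) = 3 * ε^2 / (8 * (3+ε) * s) := by
    have h3 : (3 + ε) ≠ 0 := by positivity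
    have : 1 - ε / (3+ε) = 3 / (3+ε) := by field_simp; ring
    rw [hg, hθL, this, hθdef]; field_simp; ring
  have hb := amm_prod_bound p hp0 (fun i => θ • Z i)
    (fun i => by rw [Matrix.transpose_smul, hZ]) (Real.exp (g * (4*s))) (Real.exp_pos _).le
    (by
      intro w
      have hww : 0 ≤ w ⬝ᵥ w := Finset.sum_nonneg fun j _ => mul_self_nonneg _
      calc _ ≤ ∑ i, p i * (w ⬝ᵥ w + θ * (w ⬝ᵥ Z i *ᵥ w) + g * ((Z i *ᵥ w) ⬝ᵥ (Z i *ᵥ w))) :=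
            Finset.sum_le_sum fun i _ => mul_le_mul_of_nonneg_left
              (amm_mgf (Z i) (hZ i) (4*s) θ (by positivity) hθ.le hθL3 (hmax i) w) (hp0 i)
        _ = (∑ i, p i) * (w ⬝ᵥ w) + θ * (∑ i, p i * (w ⬝ᵥ Z i *ᵥ w)) +
              g * ∑ i, p i * ((Z i *ᵥ w) ⬝ᵥ (Z i *ᵥ w)) := by
            rw [Finset.mul_sum, Finset.mul_sum, Finset.sum_mul, ← Finset.sum_add_distrib,
              ← Finset.sum_add_distrib]
            exact Finset.sum_congr rfl fun i _ => by ring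
        _ ≤ w ⬝ᵥ w + g * (4 * s * (w ⬝ᵥ w)) := by
            rw [hp1, hmean]
            have := mul_le_mul_of_nonneg_left (hvar w) hg0
            linarith
        _ = (g * (4 * s) + 1) * (w ⬝ᵥ w) := by ring
        _ ≤ _ := mul_le_mul_of_nonneg_right (Real.add_one_le_exp _) hww) m
  have hterm : ∀ ℓ : Fin m → Fin n, (if E ℓ then ∏ r, p (ℓ r) else 0) * Real.exp (θ * (m * ε)) ≤
      (∏ r, p (ℓ r)) * (exp (∑ r, θ • Z (ℓ r))).trace := by
    intro ℓ
    have hprod : 0 ≤ ∏ r, p (ℓ r) := Finset.prod_nonneg fun r _ => hp0 _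
    have hsym : (∑ r, Z (ℓ r))ᵀ = ∑ r, Z (ℓ r) := by
      rw [Matrix.transpose_sum]; simp only [hZ]
    rw [← Finset.smul_sum]
    have hnn : 0 ≤ (exp (θ • ∑ r, Z (ℓ r))).trace :=
      amm_trace_exp_nonneg _ (by rw [Matrix.transpose_smul, hsym])
    split_ifs with hEl
    · by_cases hne : ∀ r, p (ℓ r) ≠ 0
      · obtain ⟨w, hw⟩ := hE ℓ hEl hne
        exact mul_le_mul_of_nonneg_left (amm_trace_exp_ge _ hsym _ _ hθ.le w hw) hprod
      · push Not at hne
        obtain ⟨r, hr⟩ := hne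
        rw [Finset.prod_eq_zero (Finset.mem_univ r) hr]; simp
    · rw [zero_mul]; positivity
  have hsum := Finset.sum_le_sum fun ℓ (_ : ℓ ∈ Finset.univ) => hterm ℓ
  rw [← Finset.sum_mul] at hsum
  have hfin := hsum.trans hb
  rw [← Real.exp_nat_mul, ← le_div_iff₀ (Real.exp_pos _)] at hfin
  refine hfin.trans (le_of_eq ?_)
  rw [mul_comm, mul_div_assoc, ← Real.exp_sub]
  congr 2
  rw [hgs, hθdef]
  field_simp
  ring
end bern
section core
open Matrix

/-- The centred one-sample estimator. -/
noncomputable def ammW {n q d : ℕ} (X : Matrix (Fin n) (Fin q) ℝ) (Y : Matrix (Fin n) (Fin d) ℝ)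
    (p : Fin n → ℝ) (i : Fin n) : Matrix (Fin q) (Fin d) ℝ :=
  (p i)⁻¹ • vecMulVec (X i) (Y i) - Xᵀ * Y

theorem ammW_transpose {n q d : ℕ} (X : Matrix (Fin n) (Fin q) ℝ) (Y : Matrix (Fin n) (Fin d) ℝ)
    (p : Fin n → ℝ) (i : Fin n) : (ammW X Y p i)ᵀ = ammW Y X p i := by
  simp only [ammW, Matrix.transpose_sub, Matrix.transpose_smul, Matrix.transpose_mul,
    Matrix.transpose_transpose, Matrix.transpose_vecMulVec]

theorem ammW_mulVec {n q d : ℕ} (X : Matrix (Fin n) (Fin q) ℝ) (Y : Matrix (Fin n) (Fin d) ℝ)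
    (p : Fin n → ℝ) (i : Fin n) (v : Fin d → ℝ) :
    ammW X Y p i *ᵥ v = ((p i)⁻¹ * (Y i ⬝ᵥ v)) • X i - Xᵀ *ᵥ (Y *ᵥ v) := by
  rw [ammW, Matrix.sub_mulVec, Matrix.smul_mulVec, Matrix.vecMulVec_mulVec, Matrix.mulVec_mulVec]
  congr 1
  ext j
  simp [mul_assoc, mul_comm]

theorem ammW_quad {n q d : ℕ} (X : Matrix (Fin n) (Fin q) ℝ) (Y : Matrix (Fin n) (Fin d) ℝ)
    (p : Fin n → ℝ) (i : Fin n) (u : Fin q → ℝ) (v : Fin d → ℝ) :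
    u ⬝ᵥ ammW X Y p i *ᵥ v = (p i)⁻¹ * (X i ⬝ᵥ u) * (Y i ⬝ᵥ v) - (X *ᵥ u) ⬝ᵥ (Y *ᵥ v) := by
  rw [ammW_mulVec, dotProduct_sub, dotProduct_smul, Matrix.dotProduct_mulVec,
    Matrix.vecMul_transpose, dotProduct_comm u, smul_eq_mul]
  ring

theorem amm_cs {k : ℕ} (x u : Fin k → ℝ) : (x ⬝ᵥ u)^2 ≤ (x ⬝ᵥ x) * (u ⬝ᵥ u) := by
  have := Finset.sum_mul_sq_le_sq_mul_sq Finset.univ x u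
  simpa [dotProduct, pow_two] using this

theorem amm_dot_nonneg {k : Type*} [Fintype k] (x : k → ℝ) : 0 ≤ x ⬝ᵥ x :=
  Finset.sum_nonneg fun _ _ => mul_self_nonneg _

theorem amm_dot_zero {k : ℕ} (x : Fin k → ℝ) (h : x ⬝ᵥ x = 0) : x = 0 :=
  dotProduct_self_eq_zero.1 h

theorem amm_var_one {n q d : ℕ} (X : Matrix (Fin n) (Fin q) ℝ) (Y : Matrix (Fin n) (Fin d) ℝ)
    (p : Fin n → ℝ) (hp0 : ∀ i, 0 ≤ p i) (hp1 : ∑ i, p i = 1) (s : ℝ) (hs : 0 < s)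
    (hY : ∀ v, (Y *ᵥ v) ⬝ᵥ (Y *ᵥ v) ≤ v ⬝ᵥ v)
    (hrow : ∀ i, X i ⬝ᵥ X i ≤ 4 * s * p i) (v : Fin d → ℝ) :
    ∑ i, p i * ((ammW X Y p i *ᵥ v) ⬝ᵥ (ammW X Y p i *ᵥ v)) ≤ 4 * s * (v ⬝ᵥ v) := by
  set c := Xᵀ *ᵥ (Y *ᵥ v) with hc
  have hcc : c ⬝ᵥ c = ∑ i, (Y i ⬝ᵥ v) * (X i ⬝ᵥ c) := by
    conv_lhs => rw [hc]
    rw [dotProduct_comm, Matrix.dotProduct_mulVec, Matrix.vecMul_transpose, dotProduct_comm]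
    rfl
  have hterm : ∀ i, p i * ((ammW X Y p i *ᵥ v) ⬝ᵥ (ammW X Y p i *ᵥ v)) ≤
      4 * s * (Y i ⬝ᵥ v)^2 - 2 * ((Y i ⬝ᵥ v) * (X i ⬝ᵥ c)) + p i * (c ⬝ᵥ c) := by
    intro i
    rw [ammW_mulVec, ← hc]
    simp only [sub_dotProduct, dotProduct_sub, smul_dotProduct, dotProduct_smul, smul_eq_mul]
    rw [dotProduct_comm c (X i)]
    have hr := hrow i
    rcases (hp0 i).eq_or_lt with h0 | hpos
    · rw [← h0] at hr ⊢
      have : X i = 0 := amm_dot_zero _ (le_antisymm (by simpa using hr) (amm_dot_nonneg _))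
      simp [this]
      positivity
    · generalize X i ⬝ᵥ X i = A at *
      generalize X i ⬝ᵥ c = B
      generalize Y i ⬝ᵥ v = y
      generalize c ⬝ᵥ c = C
      have e : p i * ((p i)⁻¹ * y * ((p i)⁻¹ * y * A) - (p i)⁻¹ * y * B - ((p i)⁻¹ * y * B - C)) =
        (A / p i) * y^2 - 2 * (y * B) + p i * C := by field_simp; ring
      have hA : A / p i ≤ 4 * s := by rw [div_le_iff₀ hpos]; exact hr
      have := mul_le_mul_of_nonneg_right hA (sq_nonneg y)
      linarith
  calc _ ≤ ∑ i, (4 * s * (Y i ⬝ᵥ v)^2 - 2 * ((Y i ⬝ᵥ v) * (X i ⬝ᵥ c)) + p i * (c ⬝ᵥ c)) :=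
        Finset.sum_le_sum fun i _ => hterm i
    _ = 4 * s * ((Y *ᵥ v) ⬝ᵥ (Y *ᵥ v)) - c ⬝ᵥ c := by
        rw [Finset.sum_add_distrib, Finset.sum_sub_distrib, ← Finset.mul_sum, ← Finset.mul_sum,
          ← hcc, ← Finset.sum_mul, hp1]
        have : ∑ i, (Y i ⬝ᵥ v)^2 = (Y *ᵥ v) ⬝ᵥ (Y *ᵥ v) := by
          simp only [pow_two]; rfl
        rw [this]; ring
    _ ≤ _ := by
        have h1 := mul_le_mul_of_nonneg_left (hY v) (by positivity : 0 ≤ 4 * s)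
        have h2 := amm_dot_nonneg c
        linarith

theorem amm_dil_mulVec {q d : ℕ} (W : Matrix (Fin q) (Fin d) ℝ) (u : Fin q → ℝ) (v : Fin d → ℝ) :
    fromBlocks 0 W Wᵀ 0 *ᵥ Sum.elim u v = Sum.elim (W *ᵥ v) (Wᵀ *ᵥ u) := by
  rw [Matrix.fromBlocks_mulVec]; simp

theorem amm_dil_quad {q d : ℕ} (W : Matrix (Fin q) (Fin d) ℝ) (u : Fin q → ℝ) (v : Fin d → ℝ) :
    Sum.elim u v ⬝ᵥ fromBlocks 0 W Wᵀ 0 *ᵥ Sum.elim u v = 2 * (u ⬝ᵥ W *ᵥ v) := by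
  rw [amm_dil_mulVec, sumElim_dotProduct_sumElim, Matrix.dotProduct_mulVec v,
    Matrix.vecMul_transpose, dotProduct_comm (W *ᵥ v)]
  ring

open Classical in
theorem amm_core {n q d m : ℕ} (hm : 0 < m) (hq : 0 < q)
    (X : Matrix (Fin n) (Fin q) ℝ) (Y : Matrix (Fin n) (Fin d) ℝ)
    (p : Fin n → ℝ) (hp0 : ∀ i, 0 ≤ p i) (hp1 : ∑ i, p i = 1) (s : ℝ) (hs : 1/2 ≤ s)
    (hX : ∀ v, (X *ᵥ v) ⬝ᵥ (X *ᵥ v) ≤ v ⬝ᵥ v)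
    (hY : ∀ v, (Y *ᵥ v) ⬝ᵥ (Y *ᵥ v) ≤ v ⬝ᵥ v)
    (hrow : ∀ i, X i ⬝ᵥ X i + Y i ⬝ᵥ Y i ≤ 4 * s * p i)
    (ε : ℝ) (hε : 0 < ε) (E : (Fin m → Fin n) → Prop)
    (hE : ∀ ℓ, E ℓ → ∃ v, ε^2 * (v ⬝ᵥ v) <
      ((Xᵀ * (samplingMatrix m p ℓ)ᵀ * samplingMatrix m p ℓ * Y - Xᵀ * Y) *ᵥ v) ⬝ᵥ
      ((Xᵀ * (samplingMatrix m p ℓ)ᵀ * samplingMatrix m p ℓ * Y - Xᵀ * Y) *ᵥ v)) :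
    (∑ ℓ : Fin m → Fin n, if E ℓ then ∏ r, p (ℓ r) else 0) ≤
      ((q : ℝ) + d) * Real.exp (-(3 * m * ε ^ 2) / (8 * (3 + ε) * s)) := by
  have hs0 : 0 < s := by linarith
  have hrX : ∀ i, X i ⬝ᵥ X i ≤ 4 * s * p i := fun i => by
    linarith [hrow i, amm_dot_nonneg (Y i)]
  have hrY : ∀ i, Y i ⬝ᵥ Y i ≤ 4 * s * p i := fun i => by
    linarith [hrow i, amm_dot_nonneg (X i)]
  have hX0 : ∀ i, p i = 0 → X i = 0 := fun i h => by
    have := hrX i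
    rw [h, mul_zero] at this
    exact amm_dot_zero _ (le_antisymm this (amm_dot_nonneg _))
  have hne : Nonempty (Fin q ⊕ Fin d) := ⟨Sum.inl ⟨0, hq⟩⟩
  have hsplit : ∀ w : Fin q ⊕ Fin d → ℝ, ∃ u v, w = Sum.elim u v :=
    fun w => ⟨w ∘ Sum.inl, w ∘ Sum.inr, by simp⟩
  have key := amm_bernstein (m := m) p hp0 hp1
    (fun i => fromBlocks 0 (ammW X Y p i) (ammW X Y p i)ᵀ 0)
    (fun i => by simp [Matrix.fromBlocks_transpose]) s hs0 ?_ ?_ ?_ ε hε E ?_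
  · simpa using key
  · intro w
    obtain ⟨u, v, rfl⟩ := hsplit w
    simp only [amm_dil_quad, ammW_quad]
    have : ∀ i, p i * (2 * ((p i)⁻¹ * (X i ⬝ᵥ u) * (Y i ⬝ᵥ v) - (X *ᵥ u) ⬝ᵥ (Y *ᵥ v))) =
        2 * ((X i ⬝ᵥ u) * (Y i ⬝ᵥ v)) - p i * (2 * ((X *ᵥ u) ⬝ᵥ (Y *ᵥ v))) := by
      intro i
      by_cases h : p i = 0
      · simp [h, hX0 i h]
      · field_simp
    simp only [this]
    rw [Finset.sum_sub_distrib, ← Finset.mul_sum, ← Finset.sum_mul, hp1, one_mul]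
    exact sub_self _
  · intro w
    obtain ⟨u, v, rfl⟩ := hsplit w
    simp only [amm_dil_mulVec]
    simp only [sumElim_dotProduct_sumElim, ammW_transpose, mul_add, Finset.sum_add_distrib]
    have h1 := amm_var_one X Y p hp0 hp1 s hs0 hY hrX v
    have h2 := amm_var_one Y X p hp0 hp1 s hs0 hX hrY u
    linarith
  · intro i w
    obtain ⟨u, v, rfl⟩ := hsplit w
    simp only [amm_dil_quad, ammW_quad, sumElim_dotProduct_sumElim]
    have hU := amm_dot_nonneg u
    have hV := amm_dot_nonneg v
    have h1 : -(2 * ((X *ᵥ u) ⬝ᵥ (Y *ᵥ v))) ≤ u ⬝ᵥ u + v ⬝ᵥ v := by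
      have := amm_dot_nonneg (X *ᵥ u + Y *ᵥ v)
      simp only [add_dotProduct, dotProduct_add] at this
      rw [dotProduct_comm (Y *ᵥ v) (X *ᵥ u)] at this
      linarith [hX u, hY v]
    have h2 : (p i)⁻¹ * (X i ⬝ᵥ u) * (Y i ⬝ᵥ v) ≤ s * (u ⬝ᵥ u + v ⬝ᵥ v) := by
      rcases (hp0 i).eq_or_lt with h0 | hpos
      · rw [← h0]; simp; positivity
      · have ha := amm_cs (X i) u
        have hb := amm_cs (Y i) v
        have hr := hrow i
        have hA := amm_dot_nonneg (X i)
        have hB := amm_dot_nonneg (Y i)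
        generalize X i ⬝ᵥ X i = A at *
        generalize Y i ⬝ᵥ Y i = B at *
        generalize X i ⬝ᵥ u = a at *
        generalize Y i ⬝ᵥ v = b at *
        generalize u ⬝ᵥ u = U at *
        generalize v ⬝ᵥ v = V at *
        have e1 : (a * b)^2 ≤ ((A + B) * (U + V) / 4)^2 := by
          calc (a*b)^2 = a^2 * b^2 := by ring
            _ ≤ (A * U) * (B * V) := mul_le_mul ha hb (sq_nonneg _) (by positivity)
            _ = (A * B) * (U * V) := by ring
            _ ≤ ((A+B)^2/4) * ((U+V)^2/4) := by
              apply mul_le_mul _ _ (by positivity) (by positivity)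
              · nlinarith [sq_nonneg (A - B)]
              · nlinarith [sq_nonneg (U - V)]
            _ = _ := by ring
        have e2 : a * b ≤ (A + B) * (U + V) / 4 := abs_le_of_sq_le_sq e1 (by positivity) |> (le_abs_self _).trans
        have e3 : a * b ≤ s * p i * (U + V) := by
          have := mul_le_mul_of_nonneg_right hr (by positivity : 0 ≤ U + V)
          linarith
        rw [mul_assoc, inv_mul_le_iff₀ hpos]
        linarith
    nlinarith
  · intro ℓ hEl hpne
    obtain ⟨v, hv⟩ := hE ℓ hEl
    have hm' : (0:ℝ) < m := by exact_mod_cast hm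
    have hG : ∑ r, ammW X Y p (ℓ r) =
        (m : ℝ) • (Xᵀ * (samplingMatrix m p ℓ)ᵀ * samplingMatrix m p ℓ * Y - Xᵀ * Y) := by
      have hS : Xᵀ * (samplingMatrix m p ℓ)ᵀ * samplingMatrix m p ℓ * Y =
          ∑ r, ((m:ℝ) * p (ℓ r))⁻¹ • vecMulVec (X (ℓ r)) (Y (ℓ r)) := by
        have e1 : samplingMatrix m p ℓ * Y = Matrix.of fun r j => (Real.sqrt (m * p (ℓ r)))⁻¹ * Y (ℓ r) j := by
          ext r j
          simp [samplingMatrix, Matrix.mul_apply]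
        have e2 : Xᵀ * (samplingMatrix m p ℓ)ᵀ =
            Matrix.of fun j r => (Real.sqrt (m * p (ℓ r)))⁻¹ * X (ℓ r) j := by
          ext j r
          simp [samplingMatrix, Matrix.mul_apply, mul_comm]
        rw [Matrix.mul_assoc, e1, e2]
        ext j k
        rw [Matrix.mul_apply, Matrix.sum_apply]
        refine Finset.sum_congr rfl fun r _ => ?_
        simp only [Matrix.of_apply, Matrix.smul_apply, vecMulVec_apply, smul_eq_mul]
        have : ((m:ℝ) * p (ℓ r))⁻¹ = (Real.sqrt (m * p (ℓ r)))⁻¹ * (Real.sqrt (m * p (ℓ r)))⁻¹ := by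
          rw [← mul_inv, Real.mul_self_sqrt (mul_nonneg hm'.le (hp0 _))]
        rw [this]; ring
      rw [hS]
      simp only [ammW, Finset.sum_sub_distrib, smul_sub, Finset.smul_sum, smul_smul]
      congr 1
      · refine Finset.sum_congr rfl fun r _ => ?_
        rw [mul_inv, mul_inv_cancel_left₀ hm'.ne']
      · simp [Nat.cast_smul_eq_nsmul]
    generalize Xᵀ * (samplingMatrix m p ℓ)ᵀ * samplingMatrix m p ℓ * Y - Xᵀ * Y = G at *
    have hsumZ : ∑ r, fromBlocks 0 (ammW X Y p (ℓ r)) (ammW X Y p (ℓ r))ᵀ 0 =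
        (fromBlocks 0 ((m:ℝ) • G) ((m:ℝ) • G)ᵀ 0 : Matrix (Fin q ⊕ Fin d) (Fin q ⊕ Fin d) ℝ) := by
      rw [← hG]
      ext i j
      rw [Matrix.sum_apply]
      rcases i with i | i <;> rcases j with j | j <;> simp [Matrix.sum_apply]
    rw [hsumZ]
    have hgv := amm_dot_nonneg (G *ᵥ v)
    have hvv := amm_dot_nonneg v
    refine ⟨Sum.elim (Real.sqrt (v ⬝ᵥ v) • G *ᵥ v) (Real.sqrt ((G *ᵥ v) ⬝ᵥ (G *ᵥ v)) • v), ?_⟩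
    rw [amm_dil_quad]
    simp only [sumElim_dotProduct_sumElim, Matrix.mulVec_smul, Matrix.smul_mulVec,
      smul_dotProduct, dotProduct_smul, smul_eq_mul]
    have hv0 : v ⬝ᵥ v ≠ 0 := by
      intro h
      rw [amm_dot_zero v h] at hv
      simp at hv
    have hv1 : 0 < v ⬝ᵥ v := lt_of_le_of_ne hvv hv0.symm
    have hg1 : 0 < (G *ᵥ v) ⬝ᵥ (G *ᵥ v) := lt_of_le_of_lt (by positivity) hv
    generalize (G *ᵥ v) ⬝ᵥ (G *ᵥ v) = g at *
    generalize v ⬝ᵥ v = t at *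
    have hst := Real.sq_sqrt hvv
    have hsg := Real.sq_sqrt hgv
    have pt := Real.sqrt_pos.2 hv1
    have pg := Real.sqrt_pos.2 hg1
    generalize Real.sqrt t = a at *
    generalize Real.sqrt g = b at *
    subst hst hsg
    have hlt : ε * a < b := by
      apply lt_of_pow_lt_pow_left₀ 2 pg.le
      linarith [mul_pow ε a 2]
    have : 0 < (m:ℝ) * a * b^2 * (b - ε * a) := by
      have : 0 < b - ε * a := by linarith
      positivity
    nlinarith

theorem amm_le_of_sq {x y : ℝ} (h : x^2 ≤ y^2) (hy : 0 ≤ y) : x ≤ y :=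
  (le_abs_self _).trans (abs_le_of_sq_le_sq h hy)

theorem amm_op_le {n q : ℕ} (M : Matrix (Fin n) (Fin q) ℝ) (v : Fin q → ℝ) :
    (M *ᵥ v) ⬝ᵥ (M *ᵥ v) ≤ opNorm M ^ 2 * (v ⬝ᵥ v) := by
  have h := (LinearMap.toContinuousLinearMap (Matrix.toEuclideanLin M)).le_opNorm (WithLp.toLp 2 v)
  have h2 := pow_le_pow_left₀ (norm_nonneg _) h 2
  rw [mul_pow, EuclideanSpace.real_norm_sq_eq, EuclideanSpace.real_norm_sq_eq] at h2
  simpa [opNorm, dotProduct, pow_two] using h2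

theorem amm_op_gt {n q : ℕ} (M : Matrix (Fin n) (Fin q) ℝ) (c : ℝ) (hc : 0 ≤ c) (h : c < opNorm M) :
    ∃ v : Fin q → ℝ, c^2 * (v ⬝ᵥ v) < (M *ᵥ v) ⬝ᵥ (M *ᵥ v) := by
  by_contra! hcon
  refine absurd h (not_lt.2 (ContinuousLinearMap.opNorm_le_bound _ hc fun x => ?_))
  refine amm_le_of_sq ?_ (by positivity)
  rw [mul_pow, EuclideanSpace.real_norm_sq_eq, EuclideanSpace.real_norm_sq_eq]
  have := hcon x
  simpa [dotProduct, pow_two] using this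

theorem amm_op_nonneg {n q : ℕ} (M : Matrix (Fin n) (Fin q) ℝ) : 0 ≤ opNorm M := norm_nonneg _

theorem amm_op_pos {n q : ℕ} (M : Matrix (Fin n) (Fin q) ℝ) (h : M ≠ 0) : 0 < opNorm M := by
  rcases (amm_op_nonneg M).eq_or_lt with h0 | h0
  · exfalso; apply h
    have : ∀ v, M *ᵥ v = 0 := fun v => by
      have := amm_op_le M v
      rw [← h0] at this
      exact amm_dot_zero _ (le_antisymm (by simpa using this) (amm_dot_nonneg _))
    ext i j
    have := congrFun (this (Pi.single j 1)) i
    simpa using this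
  · exact h0

theorem amm_frob_sq {n q : ℕ} (M : Matrix (Fin n) (Fin q) ℝ) :
    frobNorm M ^ 2 = ∑ i, M i ⬝ᵥ M i := by
  rw [frobNorm, Real.sq_sqrt (by positivity)]
  simp [dotProduct, pow_two]

theorem amm_op_le_frob {n q : ℕ} (M : Matrix (Fin n) (Fin q) ℝ) :
    opNorm M ^ 2 ≤ frobNorm M ^ 2 := by
  by_contra! h
  have h0 : 0 ≤ frobNorm M := Real.sqrt_nonneg _
  obtain ⟨v, hv⟩ := amm_op_gt M _ h0 (lt_of_pow_lt_pow_left₀ 2 (amm_op_nonneg M) h)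
  refine absurd hv (not_lt.2 ?_)
  rw [amm_frob_sq, Finset.sum_mul]
  refine Finset.sum_le_sum fun i _ => ?_
  have := amm_cs (M i) v
  rw [pow_two] at this
  exact this

theorem amm_one_le_srank {n q : ℕ} (M : Matrix (Fin n) (Fin q) ℝ) (h : M ≠ 0) : 1 ≤ srank M := by
  have := amm_op_pos M h
  rw [srank, one_le_div (by positivity)]
  exact amm_op_le_frob M

end core

open Classical in
/-- Approximate matrix multiplication via importance sampling: tail bound.
The probability (under the i.i.d. product distribution of the sample indices
ℓ₁,…,ℓ_m drawn from {p_i}) that ‖XᵀΠᵀΠY − XᵀY‖_op exceeds ε‖X‖_op‖Y‖_op is at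
most (q+d)·exp(−3mε²/(8(3+ε)(srank X + srank Y))). -/
theorem amm_operator_norm_tail_bound {n q d m : ℕ}
    (X : Matrix (Fin n) (Fin q) ℝ) (Y : Matrix (Fin n) (Fin d) ℝ)
    (hX : X ≠ 0) (hY : Y ≠ 0)
    (p : Fin n → ℝ) (hp0 : ∀ i, 0 ≤ p i) (hp1 : ∑ i, p i = 1)
    (hplb : ∀ i,
      (1 / 4) * (((∑ j, (X i j) ^ 2) +
          (opNorm X ^ 2 / opNorm Y ^ 2) * ∑ j, (Y i j) ^ 2) /
        (frobNorm X ^ 2 + (opNorm X ^ 2 / opNorm Y ^ 2) * frobNorm Y ^ 2)) ≤ p i)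
    (ε : ℝ) (hε : 0 < ε) :
    (∑ ℓ : Fin m → Fin n,
        if ε * (opNorm X * opNorm Y) <
            opNorm (X.transpose * (samplingMatrix m p ℓ).transpose *
              samplingMatrix m p ℓ * Y - X.transpose * Y)
        then ∏ r, p (ℓ r) else 0) ≤
      ((q : ℝ) + d) *
        Real.exp (-(3 * m * ε ^ 2) / (8 * (3 + ε) * (srank X + srank Y))) := by
  have ha := amm_op_pos X hX
  have hb := amm_op_pos Y hY
  have hsX := amm_one_le_srank X hX
  have hsY := amm_one_le_srank Y hY
  have hq : 0 < q := by
    rcases Nat.eq_zero_or_pos q with h | h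
    · subst h; exact absurd (Subsingleton.elim X 0) hX
    · exact h
  rcases Nat.eq_zero_or_pos m with hm | hm
  · subst hm
    have hq1 : (1:ℝ) ≤ q := by exact_mod_cast hq
    have hd : (0:ℝ) ≤ d := Nat.cast_nonneg d
    simp only [Finset.univ_eq_empty, Finset.prod_empty, Nat.cast_zero, mul_zero, zero_mul,
      neg_zero, zero_div, Real.exp_zero, mul_one]
    rw [Fintype.sum_unique]
    split_ifs <;> linarith
  · have hmulVec : ∀ {k l : ℕ} (c : ℝ) (M : Matrix (Fin k) (Fin l) ℝ) (v : Fin l → ℝ),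
        ((c • M).mulVec v) ⬝ᵥ ((c • M).mulVec v) = c^2 * ((M.mulVec v) ⬝ᵥ (M.mulVec v)) := by
      intro k l c M v
      rw [Matrix.smul_mulVec, smul_dotProduct, dotProduct_smul, smul_eq_mul, smul_eq_mul]
      ring
    have hunit : ∀ {k l : ℕ} (M : Matrix (Fin k) (Fin l) ℝ) (_ : 0 < opNorm M) (v : Fin l → ℝ),
        (((opNorm M)⁻¹ • M).mulVec v) ⬝ᵥ (((opNorm M)⁻¹ • M).mulVec v) ≤ v ⬝ᵥ v := by
      intro k l M hM v
      rw [hmulVec, inv_pow, inv_mul_le_iff₀ (by positivity)]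
      exact amm_op_le M v
    refine amm_core hm hq ((opNorm X)⁻¹ • X) ((opNorm Y)⁻¹ • Y) p hp0 hp1 (srank X + srank Y)
      (by linarith) (hunit X ha) (hunit Y hb) ?_ ε hε _ ?_
    · intro i
      have h := hplb i
      have e1 : ∀ {k l : ℕ} (c : ℝ) (M : Matrix (Fin k) (Fin l) ℝ) (i : Fin k),
          (c • M) i ⬝ᵥ (c • M) i = c^2 * ∑ j, (M i j)^2 := by
        intro k l c M i
        simp only [dotProduct, Matrix.smul_apply, smul_eq_mul, Finset.mul_sum]
        exact Finset.sum_congr rfl fun j _ => by ring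
      rw [e1, e1]
      generalize (∑ j, (X i j)^2) = A at *
      generalize (∑ j, (Y i j)^2) = B at *
      have e2 : (1 / 4) * ((A + (opNorm X ^ 2 / opNorm Y ^ 2) * B) /
          (frobNorm X ^ 2 + (opNorm X ^ 2 / opNorm Y ^ 2) * frobNorm Y ^ 2)) =
          ((opNorm X)⁻¹^2 * A + (opNorm Y)⁻¹^2 * B) / (4 * (srank X + srank Y)) := by
        have e3 : A + (opNorm X ^ 2 / opNorm Y ^ 2) * B =
            opNorm X ^ 2 * ((opNorm X)⁻¹^2 * A + (opNorm Y)⁻¹^2 * B) := by field_simp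
        have e4 : frobNorm X ^ 2 + (opNorm X ^ 2 / opNorm Y ^ 2) * frobNorm Y ^ 2 =
            opNorm X ^ 2 * (srank X + srank Y) := by rw [srank, srank]; field_simp
        rw [e3, e4, mul_div_mul_left _ _ (by positivity), div_mul_div_comm, one_mul]
      rw [e2, div_le_iff₀ (by linarith)] at h
      linarith
    · intro ℓ hE
      obtain ⟨v, hv⟩ := amm_op_gt _ _ (by positivity) hE
      refine ⟨v, ?_⟩
      have e5 : ((opNorm X)⁻¹ • X).transpose * (samplingMatrix m p ℓ).transpose *
          samplingMatrix m p ℓ * ((opNorm Y)⁻¹ • Y) -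
          ((opNorm X)⁻¹ • X).transpose * ((opNorm Y)⁻¹ • Y) =
          ((opNorm X)⁻¹ * (opNorm Y)⁻¹) • (X.transpose * (samplingMatrix m p ℓ).transpose *
              samplingMatrix m p ℓ * Y - X.transpose * Y) := by
        simp only [Matrix.transpose_smul, Matrix.smul_mul, Matrix.mul_smul, smul_smul, smul_sub]
        rw [mul_comm (opNorm Y)⁻¹]
      rw [e5, hmulVec, ← mul_inv, inv_pow, lt_inv_mul_iff₀ (by positivity)]
      linarith
end

section
/- Let d ≥ 1 and r ≥ 1 be integers, and let w₁, …, w_r be i.i.d. random vectors drawn from the standard Gaussian distribution N(0, I_d) on ℝ^d. Define the rank-r angular LSH h : ℝ^d → {0,1}^r by h(x) := (𝟙{⟨w₁,x⟩ ≥ 0}, …, 𝟙{⟨w_r,x⟩ ≥ 0}). Then for any nonzero x, y ∈ ℝ^d, the collision probability is Pr[h(x) = h(y)] = (1 − θ_{x,y}/π)^r, where θ_{x,y} := arccos(⟨x,y⟩/(‖x‖₂·‖y‖₂)) is the angle between x and y. -/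
open MeasureTheory

lemma lsh_charfun {d : ℕ} (c : Fin d → ℝ) :
    ∫ w : Fin d → ℝ, Complex.exp (((∑ a, w a * c a : ℝ) : ℂ) * Complex.I)
      ∂(Measure.pi (fun _ : Fin d => ProbabilityTheory.gaussianReal 0 1)) =
    Complex.exp (-((∑ a, c a ^ 2 : ℝ) : ℂ) / 2) := by
  have h1 : ∀ w : Fin d → ℝ, Complex.exp (((∑ a, w a * c a : ℝ) : ℂ) * Complex.I) =
      ∏ a, Complex.exp ((c a : ℂ) * (w a : ℂ) * Complex.I) := by
    intro w
    rw [← Complex.exp_sum, ← Finset.sum_mul]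
    push_cast
    congr 2
    exact Finset.sum_congr rfl fun a _ => mul_comm _ _
  simp_rw [h1]
  rw [integral_fintype_prod_eq_prod (𝕜 := ℂ)
    (fun a (t : ℝ) => Complex.exp ((c a : ℂ) * (t : ℂ) * Complex.I))]
  simp_rw [← charFun_apply_real, ProbabilityTheory.charFun_gaussianReal]
  rw [← Complex.exp_sum]
  congr 1
  push_cast
  rw [← Finset.sum_neg_distrib, Finset.sum_div]
  refine Finset.sum_congr rfl fun a _ => ?_
  ring

lemma lsh_gram {d e : ℕ} (x y : Fin d → ℝ) (x' y' : Fin e → ℝ)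
    (hxx : ∑ a, x a ^ 2 = ∑ a, x' a ^ 2) (hyy : ∑ a, y a ^ 2 = ∑ a, y' a ^ 2)
    (hxy : ∑ a, x a * y a = ∑ a, x' a * y' a) :
    (Measure.pi (fun _ : Fin d => ProbabilityTheory.gaussianReal 0 1)).map
      (fun w => (∑ a, w a * x a, ∑ a, w a * y a)) =
    (Measure.pi (fun _ : Fin e => ProbabilityTheory.gaussianReal 0 1)).map
      (fun w => (∑ a, w a * x' a, ∑ a, w a * y' a)) := by
  have key : ∀ (n : ℕ) (u v : Fin n → ℝ) (L : StrongDual ℝ (ℝ × ℝ)),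
      charFunDual ((Measure.pi (fun _ : Fin n => ProbabilityTheory.gaussianReal 0 1)).map
        (fun w => (∑ a, w a * u a, ∑ a, w a * v a))) L =
      Complex.exp (-((L (1, 0) ^ 2 * ∑ a, u a ^ 2 + L (0, 1) ^ 2 * ∑ a, v a ^ 2 +
        2 * L (1, 0) * L (0, 1) * ∑ a, u a * v a : ℝ) : ℂ) / 2) := by
    intro n u v L
    have hL : ∀ p q : ℝ, L (p, q) = p * L (1, 0) + q * L (0, 1) := by
      intro p q
      have : (p, q) = p • ((1 : ℝ), (0 : ℝ)) + q • ((0 : ℝ), (1 : ℝ)) := by simp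
      rw [this, map_add, map_smul, map_smul, smul_eq_mul, smul_eq_mul]
    rw [charFunDual_apply, integral_map (by fun_prop) (by fun_prop)]
    have h2 : ∀ w : Fin n → ℝ, L (∑ a, w a * u a, ∑ a, w a * v a) =
        ∑ a, w a * (L (1, 0) * u a + L (0, 1) * v a) := by
      intro w
      rw [hL, Finset.sum_mul, Finset.sum_mul, ← Finset.sum_add_distrib]
      exact Finset.sum_congr rfl fun a _ => by ring
    simp_rw [h2]
    rw [lsh_charfun]
    congr 4
    rw [Finset.mul_sum, Finset.mul_sum, Finset.mul_sum, ← Finset.sum_add_distrib,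
      ← Finset.sum_add_distrib]
    exact Finset.sum_congr rfl fun a _ => by ring
  have : IsProbabilityMeasure ((Measure.pi (fun _ : Fin d =>
      ProbabilityTheory.gaussianReal 0 1)).map (fun w => (∑ a, w a * x a, ∑ a, w a * y a))) :=
    Measure.isProbabilityMeasure_map (by fun_prop)
  have : IsProbabilityMeasure ((Measure.pi (fun _ : Fin e =>
      ProbabilityTheory.gaussianReal 0 1)).map (fun w => (∑ a, w a * x' a, ∑ a, w a * y' a))) :=
    Measure.isProbabilityMeasure_map (by fun_prop)
  apply Measure.ext_of_charFunDual
  ext L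
  rw [key, key, hxx, hyy, hxy]

lemma lsh_polar : ∃ C : ENNReal, ∀ (T : Set (ℝ × ℝ)) (S : Set ℝ), MeasurableSet T →
    MeasurableSet S →
    (∀ ρ : ℝ, 0 < ρ → ∀ φ ∈ Set.Ioo (-Real.pi) Real.pi,
      ((ρ * Real.cos φ, ρ * Real.sin φ) ∈ T ↔ φ ∈ S)) →
    ((ProbabilityTheory.gaussianReal 0 1).prod (ProbabilityTheory.gaussianReal 0 1)) T =
      C * volume (S ∩ Set.Ioo (-Real.pi) Real.pi) := by
  refine ⟨∫⁻ ρ in Set.Ioi (0 : ℝ), ENNReal.ofReal ρ *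
    ENNReal.ofReal ((Real.sqrt (2 * Real.pi))⁻¹ * (Real.sqrt (2 * Real.pi))⁻¹ *
      Real.exp (-ρ ^ 2 / 2)), ?_⟩
  intro T S hT hS h
  rw [ProbabilityTheory.gaussianReal_of_var_ne_zero 0 one_ne_zero,
    prod_withDensity (by fun_prop) (by fun_prop), withDensity_apply _ hT,
    ← lintegral_indicator hT, ← Measure.volume_eq_prod, ← lintegral_comp_polarCoord_symm]
  have e1 : ∫⁻ (p : ℝ × ℝ) in polarCoord.target, ENNReal.ofReal p.1 •
      T.indicator (fun z => ProbabilityTheory.gaussianPDF 0 1 z.1 *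
        ProbabilityTheory.gaussianPDF 0 1 z.2) (polarCoord.symm p) =
      ∫⁻ (p : ℝ × ℝ) in Set.Ioi (0 : ℝ) ×ˢ Set.Ioo (-Real.pi) Real.pi,
        (ENNReal.ofReal p.1 *
    ENNReal.ofReal ((Real.sqrt (2 * Real.pi))⁻¹ * (Real.sqrt (2 * Real.pi))⁻¹ *
      Real.exp (-p.1 ^ 2 / 2))) * S.indicator 1 p.2 := by
    refine setLIntegral_congr_fun (measurableSet_Ioi.prod measurableSet_Ioo) ?_
    rintro ⟨ρ, φ⟩ ⟨hρ, hφ⟩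
    have hh := h ρ hρ φ hφ
    simp only [polarCoord_symm_apply, smul_eq_mul]
    by_cases hm : φ ∈ S
    · rw [Set.indicator_of_mem (hh.2 hm), Set.indicator_of_mem hm]
      simp only [Pi.one_apply, mul_one]
      congr 1
      rw [ProbabilityTheory.gaussianPDF, ProbabilityTheory.gaussianPDF,
        ← ENNReal.ofReal_mul (ProbabilityTheory.gaussianPDFReal_nonneg _ _ _)]
      congr 1
      simp only [ProbabilityTheory.gaussianPDFReal, NNReal.coe_one, mul_one, sub_zero]
      rw [mul_mul_mul_comm, ← Real.exp_add]
      congr 2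
      have := Real.sin_sq_add_cos_sq φ
      linear_combination (-ρ ^ 2 / 2) * this
    · rw [Set.indicator_of_notMem (fun q => hm (hh.1 q)), Set.indicator_of_notMem hm]
      simp
  rw [e1, Measure.volume_eq_prod, ← Measure.prod_restrict,
    lintegral_prod_mul (f := fun ρ : ℝ => ENNReal.ofReal ρ *
      ENNReal.ofReal ((Real.sqrt (2 * Real.pi))⁻¹ * (Real.sqrt (2 * Real.pi))⁻¹ *
        Real.exp (-ρ ^ 2 / 2))) (by fun_prop) ((measurable_one.indicator hS).aemeasurable),
    lintegral_indicator_one hS, Measure.restrict_apply hS]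

lemma lsh_cos {φ : ℝ} (h1 : -(3 * Real.pi / 2) < φ) (h2 : φ < 3 * Real.pi / 2) :
    0 ≤ Real.cos φ ↔ (-(Real.pi / 2) ≤ φ ∧ φ ≤ Real.pi / 2) := by
  constructor
  · intro h
    constructor
    · by_contra! hc
      have := Real.cos_neg_of_pi_div_two_lt_of_lt (x := -φ) (by linarith) (by linarith)
      rw [Real.cos_neg] at this
      linarith
    · by_contra! hc
      have := Real.cos_neg_of_pi_div_two_lt_of_lt (x := φ) (by linarith) (by linarith)
      linarith
  · rintro ⟨a, b⟩
    exact Real.cos_nonneg_of_neg_pi_div_two_le_of_le (by linarith) b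

lemma lsh_two (t : ℝ) (ht0 : 0 ≤ t) (ht1 : t ≤ Real.pi / 2) :
    ((ProbabilityTheory.gaussianReal 0 1).prod (ProbabilityTheory.gaussianReal 0 1))
      {p : ℝ × ℝ | (0 ≤ p.1 * Real.cos t + p.2 * (-Real.sin t)) ↔
        (0 ≤ p.1 * Real.cos t + p.2 * Real.sin t)} =
      ENNReal.ofReal (1 - 2 * t / Real.pi) := by
  have hpi := Real.pi_pos
  obtain ⟨C, hC⟩ := lsh_polar
  have hone := hC Set.univ Set.univ MeasurableSet.univ MeasurableSet.univ (by simp)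
  rw [measure_univ, Set.univ_inter, Real.volume_Ioo] at hone
  rw [hC _ (Set.Iio (-(Real.pi / 2) - t) ∪ Set.Icc (t - Real.pi / 2) (Real.pi / 2 - t) ∪
    Set.Ioi (Real.pi / 2 + t)) ?_ (by measurability) ?_]
  · have hset : (Set.Iio (-(Real.pi / 2) - t) ∪ Set.Icc (t - Real.pi / 2) (Real.pi / 2 - t) ∪
        Set.Ioi (Real.pi / 2 + t)) ∩ Set.Ioo (-Real.pi) Real.pi =
        (Set.Ioo (-Real.pi) (-(Real.pi / 2) - t) ∪
          Set.Icc (t - Real.pi / 2) (Real.pi / 2 - t)) ∪ Set.Ioo (Real.pi / 2 + t) Real.pi := by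
      ext φ
      simp only [Set.mem_inter_iff, Set.mem_union, Set.mem_Iio, Set.mem_Icc, Set.mem_Ioi,
        Set.mem_Ioo]
      constructor
      · rintro ⟨(h | h) | h, h1, h2⟩
        · exact Or.inl (Or.inl ⟨h1, h⟩)
        · exact Or.inl (Or.inr h)
        · exact Or.inr ⟨h, h2⟩
      · rintro ((⟨h1, h⟩ | ⟨h1, h2⟩) | ⟨h1, h2⟩)
        · exact ⟨Or.inl (Or.inl h), h1, by linarith⟩
        · exact ⟨Or.inl (Or.inr ⟨h1, h2⟩), by linarith, by linarith⟩
        · exact ⟨Or.inr h1, by linarith, h2⟩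
    rw [hset, measure_union ?_ measurableSet_Ioo,
      measure_union ?_ measurableSet_Icc, Real.volume_Ioo, Real.volume_Icc, Real.volume_Ioo,
      ← ENNReal.ofReal_add (by linarith) (by linarith),
      ← ENNReal.ofReal_add (by linarith) (by linarith)]
    · have : -(Real.pi / 2) - t - -Real.pi + (Real.pi / 2 - t - (t - Real.pi / 2)) +
          (Real.pi - (Real.pi / 2 + t)) =
          (Real.pi - -Real.pi) * (1 - 2 * t / Real.pi) := by
        field_simp
        ring
      rw [this, ENNReal.ofReal_mul (by linarith), ← mul_assoc, ← hone, one_mul]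
    · rw [Set.disjoint_left]
      rintro φ ⟨a, b⟩ ⟨c, d⟩
      linarith
    · rw [Set.disjoint_left]
      rintro φ (⟨a, b⟩ | ⟨a, b⟩) ⟨c, d⟩ <;> linarith
  · apply MeasurableSet.iff <;> exact measurableSet_le (by fun_prop) (by fun_prop)
  · rintro ρ hρ φ ⟨h1, h2⟩
    have e1 : ρ * Real.cos φ * Real.cos t + ρ * Real.sin φ * (-Real.sin t) =
        ρ * Real.cos (φ + t) := by rw [Real.cos_add]; ring
    have e2 : ρ * Real.cos φ * Real.cos t + ρ * Real.sin φ * Real.sin t =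
        ρ * Real.cos (φ - t) := by rw [Real.cos_sub]; ring
    simp only [Set.mem_ofPred_eq, e1, e2, mul_nonneg_iff_of_pos_left hρ]
    rw [lsh_cos (by linarith) (by linarith), lsh_cos (by linarith) (by linarith)]
    simp only [Set.mem_union, Set.mem_Iio, Set.mem_Icc, Set.mem_Ioi]
    constructor
    · intro h
      by_contra! hc
      obtain ⟨⟨c1, c2⟩, c3⟩ := hc
      by_cases hq : t - Real.pi / 2 ≤ φ
      · have := c2 hq
        have := h.2 ⟨by linarith, by linarith⟩
        linarith [this.2]
      · push Not at hq
        have := h.1 ⟨by linarith, by linarith⟩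
        linarith [this.1]
    · rintro ((h | ⟨h, h'⟩) | h)
      · constructor <;> rintro ⟨a, b⟩ <;> exfalso <;> linarith
      · constructor <;> rintro ⟨a, b⟩ <;> constructor <;> linarith
      · constructor <;> rintro ⟨a, b⟩ <;> exfalso <;> linarith

lemma lsh_one {d : ℕ} (x y : Fin d → ℝ) (hx : x ≠ 0) (hy : y ≠ 0) :
    Measure.pi (fun _ : Fin d => ProbabilityTheory.gaussianReal 0 1)
        {w : Fin d → ℝ | (0 ≤ ∑ a, w a * x a) ↔ (0 ≤ ∑ a, w a * y a)} =
      ENNReal.ofReal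
        (1 - Real.arccos ((∑ a, x a * y a) /
            (Real.sqrt (∑ a, x a ^ 2) * Real.sqrt (∑ a, y a ^ 2))) / Real.pi) := by
  have pos : ∀ z : Fin d → ℝ, z ≠ 0 → 0 < ∑ a, z a ^ 2 := by
    intro z hz
    obtain ⟨i, hi⟩ := Function.ne_iff.1 hz
    exact Finset.sum_pos' (fun _ _ => sq_nonneg _) ⟨i, Finset.mem_univ _, sq_pos_of_ne_zero (show z i ≠ 0 from hi)⟩
  have hX := Real.sqrt_pos.2 (pos x hx)
  have hY := Real.sqrt_pos.2 (pos y hy)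
  have hX2 := Real.sq_sqrt (pos x hx).le
  have hY2 := Real.sq_sqrt (pos y hy).le
  set X := Real.sqrt (∑ a, x a ^ 2)
  set Y := Real.sqrt (∑ a, y a ^ 2)
  have hCS : |∑ a, x a * y a| ≤ X * Y := by
    apply abs_le_of_sq_le_sq _ (by positivity)
    rw [mul_pow, hX2, hY2]
    exact Finset.sum_mul_sq_le_sq_mul_sq _ _ _
  obtain ⟨hc1, hc2⟩ := abs_le.1 hCS
  set c := (∑ a, x a * y a) / (X * Y) with hc
  have hcos : Real.cos (Real.arccos c) = c := by
    apply Real.cos_arccos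
    · rw [hc, le_div_iff₀ (by positivity)]; linarith
    · rw [hc, div_le_iff₀ (by positivity)]; linarith
  obtain ⟨t, ht⟩ : ∃ t, Real.arccos c = 2 * t := ⟨Real.arccos c / 2, by ring⟩
  have ht0 : 0 ≤ t := by linarith [Real.arccos_nonneg c]
  have ht1 : t ≤ Real.pi / 2 := by linarith [Real.arccos_le_pi c]
  have hsc := Real.sin_sq_add_cos_sq t
  rw [ht, ← lsh_two t ht0 ht1]
  rw [ht, Real.cos_two_mul] at hcos
  have hg := lsh_gram x y ![X * Real.cos t, X * (-Real.sin t)] ![Y * Real.cos t, Y * Real.sin t]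
    (by simp [Fin.sum_univ_two]; linear_combination -hX2 - X ^ 2 * hsc)
    (by simp [Fin.sum_univ_two]; linear_combination -hY2 - Y ^ 2 * hsc)
    (by
      have : ∑ a, x a * y a = c * (X * Y) := by rw [hc]; field_simp
      rw [this]
      simp [Fin.sum_univ_two]; linear_combination (-X * Y) * hcos + X * Y * hsc)
  have hM : MeasurableSet {p : ℝ × ℝ | 0 ≤ p.1 ↔ 0 ≤ p.2} := by
    apply MeasurableSet.iff <;> exact measurableSet_le (by fun_prop) (by fun_prop)
  have hg2 := congrArg (fun m => m {p : ℝ × ℝ | 0 ≤ p.1 ↔ 0 ≤ p.2}) hg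
  rw [Measure.map_apply (by fun_prop) hM, Measure.map_apply (by fun_prop) hM] at hg2
  refine hg2.trans ?_
  rw [← (measurePreserving_finTwoArrow (ProbabilityTheory.gaussianReal 0 1)).measure_preimage_equiv]
  congr 1
  ext w
  simp only [Set.mem_preimage, Set.mem_ofPred_eq, Fin.sum_univ_two, MeasurableEquiv.finTwoArrow_apply,
    Matrix.cons_val_zero, Matrix.cons_val_one]
  have e1 : w 0 * (X * Real.cos t) + w 1 * (X * (-Real.sin t)) =
    X * (w 0 * Real.cos t + w 1 * (-Real.sin t)) := by ring
  have e2 : w 0 * (Y * Real.cos t) + w 1 * (Y * Real.sin t) =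
    Y * (w 0 * Real.cos t + w 1 * Real.sin t) := by ring
  rw [e1, e2, mul_nonneg_iff_of_pos_left hX, mul_nonneg_iff_of_pos_left hY]

/-- Collision probability of the rank-r angular LSH: with w₁,…,w_r i.i.d. standard Gaussian
vectors in ℝ^d (modeled by the product measure over r copies of the standard Gaussian
product measure on ℝ^d), the probability that the r sign-patterns of ⟨w_s, x⟩ and
⟨w_s, y⟩ all agree equals (1 − θ_{x,y}/π)^r, where θ_{x,y} = arccos(⟨x,y⟩/(‖x‖‖y‖)). -/
theorem angular_lsh_collision_probability {d r : ℕ} (hd : 1 ≤ d) (hr : 1 ≤ r)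
    (x y : Fin d → ℝ) (hx : x ≠ 0) (hy : y ≠ 0) :
    Measure.pi (fun _ : Fin r => Measure.pi (fun _ : Fin d => ProbabilityTheory.gaussianReal 0 1))
        {W : Fin r → Fin d → ℝ |
          ∀ s, ((0 ≤ ∑ a, W s a * x a) ↔ (0 ≤ ∑ a, W s a * y a))} =
      ENNReal.ofReal
        ((1 - Real.arccos ((∑ a, x a * y a) /
            (Real.sqrt (∑ a, x a ^ 2) * Real.sqrt (∑ a, y a ^ 2))) / Real.pi) ^ r) := by
  have hset : {W : Fin r → Fin d → ℝ |
      ∀ s, ((0 ≤ ∑ a, W s a * x a) ↔ (0 ≤ ∑ a, W s a * y a))} =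
      Set.pi Set.univ (fun _ : Fin r =>
        {w : Fin d → ℝ | (0 ≤ ∑ a, w a * x a) ↔ (0 ≤ ∑ a, w a * y a)}) := by
    ext W
    simp
  rw [hset, Measure.pi_pi, Finset.prod_const, lsh_one x y hx hy, Finset.card_univ,
    Fintype.card_fin, ENNReal.ofReal_pow]
  rw [sub_nonneg, div_le_one Real.pi_pos]
  exact Real.arccos_le_pi _
end

section
/- Let d ≥ 1 and let w be a random vector drawn from the standard Gaussian distribution N(0, I_d) on ℝ^d. Then for any nonzero x, y ∈ ℝ^d, Pr[𝟙{⟨w,x⟩ ≥ 0} = 𝟙{⟨w,y⟩ ≥ 0}] = 1 − θ_{x,y}/π, where θ_{x,y} := arccos(⟨x,y⟩/(‖x‖₂·‖y‖₂)) is the angle between x and y. -/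
open MeasureTheory ProbabilityTheory
open scoped ENNReal RealInnerProductSpace

/-- The pair of inner products. -/
noncomputable def rhPair {E : Type*} [NormedAddCommGroup E] [InnerProductSpace ℝ E] (u v : E) :
    E →L[ℝ] ℝ × ℝ := (innerSL ℝ u).prod (innerSL ℝ v)

lemma rh_charFun {E : Type*} [NormedAddCommGroup E] [InnerProductSpace ℝ E]
    [FiniteDimensional ℝ E] [MeasurableSpace E] [BorelSpace E] (u v : E)
    (l : StrongDual ℝ (ℝ × ℝ)) :
    charFunDual ((stdGaussian E).map (rhPair u v)) l =
      Complex.exp (-((l (1,0)^2 * ‖u‖^2 + 2 * (l (1,0) * l (0,1) * ⟪u, v⟫) + l (0,1)^2 * ‖v‖^2 : ℝ) : ℂ) / 2) := by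
  rw [charFunDual_map, charFunDual_stdGaussian]
  have : l.comp (rhPair u v) = innerSL ℝ (l (1,0) • u + l (0,1) • v) := by
    ext w
    have h : (rhPair u v) w = ⟪u, w⟫ • ((1:ℝ),(0:ℝ)) + ⟪v, w⟫ • ((0:ℝ),(1:ℝ)) := by
      simp [rhPair]
    simp only [ContinuousLinearMap.comp_apply, h, map_add, map_smul]
    simp [mul_comm]
  rw [this, innerSL_apply_norm, ← Complex.ofReal_pow, norm_add_sq_real]
  simp only [norm_smul, inner_smul_left, inner_smul_right, mul_pow, Real.norm_eq_abs, sq_abs]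
  simp [mul_assoc, mul_left_comm]

lemma rh_map_eq {E F : Type*} [NormedAddCommGroup E] [InnerProductSpace ℝ E]
    [FiniteDimensional ℝ E] [MeasurableSpace E] [BorelSpace E]
    [NormedAddCommGroup F] [InnerProductSpace ℝ F]
    [FiniteDimensional ℝ F] [MeasurableSpace F] [BorelSpace F] (u v : E) (u' v' : F)
    (hu : ‖u‖ = ‖u'‖) (hv : ‖v‖ = ‖v'‖) (h : ⟪u, v⟫ = ⟪u', v'⟫) :
    (stdGaussian E).map (rhPair u v) = (stdGaussian F).map (rhPair u' v') := by
  have := Measure.isProbabilityMeasure_map (μ := stdGaussian E) (rhPair u v).continuous.aemeasurable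
  have := Measure.isProbabilityMeasure_map (μ := stdGaussian F) (rhPair u' v').continuous.aemeasurable
  apply Measure.ext_of_charFunDual
  ext l
  rw [rh_charFun, rh_charFun, hu, hv, h]

lemma rh_polar : ∃ K : ℝ≥0∞, ∀ (S : Set (ℝ × ℝ)) (A : Set ℝ), MeasurableSet S → MeasurableSet A →
    (∀ r φ : ℝ, 0 < r → φ ∈ Set.Ioo (-Real.pi) Real.pi →
      ((r * Real.cos φ, r * Real.sin φ) ∈ S ↔ φ ∈ A)) →
    ((gaussianReal 0 1).prod (gaussianReal 0 1)) S =
      K * volume (A ∩ Set.Ioo (-Real.pi) Real.pi) := by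
  refine ⟨∫⁻ r in Set.Ioi (0:ℝ), ENNReal.ofReal r * ENNReal.ofReal ((2 * Real.pi)⁻¹ * Real.exp (-r^2/2)), ?_⟩
  intro S A hS hA h
  rw [gaussianReal_of_var_ne_zero _ one_ne_zero, prod_withDensity (by fun_prop) (by fun_prop),
    withDensity_apply _ hS, ← lintegral_indicator hS]
  change ∫⁻ p : ℝ × ℝ, _ = _
  rw [← lintegral_comp_polarCoord_symm]
  have : volume (A ∩ Set.Ioo (-Real.pi) Real.pi) =
      ∫⁻ φ in Set.Ioo (-Real.pi) Real.pi, A.indicator 1 φ := by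
    rw [lintegral_indicator hA]; simp [Measure.restrict_restrict hA]
  rw [this, polarCoord_target, Measure.volume_eq_prod, ← Measure.prod_restrict,
    ← lintegral_prod_mul (by fun_prop) ((measurable_one.indicator hA).aemeasurable),
    Measure.prod_restrict]
  refine setLIntegral_congr_fun (measurableSet_Ioi.prod measurableSet_Ioo) ?_
  rintro ⟨r, φ⟩ ⟨hr, hφ⟩
  simp only [polarCoord_symm_apply]
  have hh := h r φ hr hφ
  by_cases hm : φ ∈ A
  · rw [Set.indicator_of_mem (hh.2 hm), Set.indicator_of_mem hm]
    simp only [Pi.one_apply, mul_one, smul_eq_mul, gaussianPDF]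
    rw [← ENNReal.ofReal_mul (gaussianPDFReal_nonneg _ _ _)]
    congr 2
    simp only [gaussianPDFReal, NNReal.coe_one, sub_zero, mul_one]
    rw [mul_mul_mul_comm, ← Real.exp_add, ← mul_inv, Real.mul_self_sqrt (by positivity)]
    congr 2
    have := Real.sin_sq_add_cos_sq φ
    linear_combination (-r^2/2) * this
  · rw [Set.indicator_of_notMem (fun h' => hm (hh.1 h')), Set.indicator_of_notMem hm]
    simp

lemma rh_sector (S : Set (ℝ × ℝ)) (A : Set ℝ) (hS : MeasurableSet S) (hA : MeasurableSet A)
    (h : ∀ r φ : ℝ, 0 < r → φ ∈ Set.Ioo (-Real.pi) Real.pi →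
      ((r * Real.cos φ, r * Real.sin φ) ∈ S ↔ φ ∈ A)) :
    ((gaussianReal 0 1).prod (gaussianReal 0 1)) S =
      volume (A ∩ Set.Ioo (-Real.pi) Real.pi) / ENNReal.ofReal (2 * Real.pi) := by
  obtain ⟨K, hK⟩ := rh_polar
  have h1 := hK Set.univ Set.univ .univ .univ (by simp)
  rw [measure_univ, Set.univ_inter, Real.volume_Ioo, show Real.pi - -Real.pi = 2 * Real.pi by ring] at h1
  rw [hK S A hS hA h, ENNReal.eq_inv_of_mul_eq_one_left h1.symm, mul_comm, div_eq_mul_inv]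

lemma rh_cos (α φ : ℝ) (h0 : 0 ≤ α) (h1 : α ≤ Real.pi / 2)
    (hφ : φ ∈ Set.Ioo (-Real.pi) Real.pi) :
    ((0 ≤ Real.cos (φ - α) ↔ 0 ≤ Real.cos (φ + α)) ↔
      φ ∈ Set.Icc (-(Real.pi/2 - α)) (Real.pi/2 - α) ∪ (Set.Ioo (-Real.pi) (-(Real.pi/2 + α)) ∪
        Set.Ioo (Real.pi/2+α) Real.pi)) := by
  wlog hp : 0 ≤ φ generalizing φ
  · have := this (-φ) ⟨by linarith [hφ.2], by linarith [hφ.1]⟩ (by linarith)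
    rw [show -φ - α = -(φ + α) by ring, show -φ + α = -(φ - α) by ring, Real.cos_neg, Real.cos_neg,
      iff_comm (a := 0 ≤ Real.cos (φ + α))] at this
    rw [this]
    simp only [Set.mem_union, Set.mem_Icc, Set.mem_Ioo]
    grind
  obtain ⟨h2, h3⟩ := hφ
  have hpi := Real.pi_pos
  simp only [Set.mem_union, Set.mem_Icc, Set.mem_Ioo]
  rcases le_or_gt φ (Real.pi/2 - α) with ha | ha
  · have c1 := Real.cos_nonneg_of_neg_pi_div_two_le_of_le (x := φ - α) (by linarith) (by linarith)
    have c2 := Real.cos_nonneg_of_neg_pi_div_two_le_of_le (x := φ + α) (by linarith) (by linarith)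
    simp only [c1, c2, true_iff]
    left; constructor <;> linarith
  rcases le_or_gt φ (Real.pi/2 + α) with hb | hb
  · have c1 := Real.cos_nonneg_of_neg_pi_div_two_le_of_le (x := φ - α) (by linarith) (by linarith)
    have c2 := Real.cos_neg_of_pi_div_two_lt_of_lt (x := φ + α) (by linarith) (by linarith)
    simp only [c1, not_le.2 c2, true_iff, false_iff]
    grind
  · have c1 := Real.cos_neg_of_pi_div_two_lt_of_lt (x := φ - α) (by linarith) (by linarith)
    have c2 := Real.cos_neg_of_pi_div_two_lt_of_lt (x := φ + α) (by linarith) (by linarith)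
    simp only [not_le.2 c1, not_le.2 c2, true_iff]
    grind

lemma rh_vol (α : ℝ) (h0 : 0 ≤ α) (h1 : α ≤ Real.pi / 2) :
    volume ((Set.Icc (-(Real.pi/2 - α)) (Real.pi/2 - α) ∪ (Set.Ioo (-Real.pi) (-(Real.pi/2 + α)) ∪
        Set.Ioo (Real.pi/2+α) Real.pi)) ∩ Set.Ioo (-Real.pi) Real.pi) =
      ENNReal.ofReal (2 * Real.pi - 4 * α) := by
  have hpi := Real.pi_pos
  rw [Set.inter_eq_left.2, measure_union, measure_union, Real.volume_Icc, Real.volume_Ioo,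
    Real.volume_Ioo, ← ENNReal.ofReal_add, ← ENNReal.ofReal_add]
  · congr 1; ring
  any_goals linarith
  any_goals measurability
  · rw [Set.disjoint_left]; intro a; simp only [Set.mem_Ioo]; grind
  · rw [Set.disjoint_left]; intro a; simp only [Set.mem_union, Set.mem_Icc, Set.mem_Ioo]; grind
  · intro a; simp only [Set.mem_union, Set.mem_Icc, Set.mem_Ioo]; grind

lemma rh_plane (α : ℝ) (h0 : 0 ≤ α) (h1 : α ≤ Real.pi / 2) :
    ((gaussianReal 0 1).prod (gaussianReal 0 1))
      {p : ℝ × ℝ | 0 ≤ p.1 * Real.cos α + p.2 * Real.sin α ↔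
        0 ≤ p.1 * Real.cos α - p.2 * Real.sin α} = ENNReal.ofReal (1 - 2 * α / Real.pi) := by
  have hpi := Real.pi_pos
  rw [rh_sector _ (Set.Icc (-(Real.pi/2 - α)) (Real.pi/2 - α) ∪ (Set.Ioo (-Real.pi) (-(Real.pi/2 + α)) ∪
        Set.Ioo (Real.pi/2+α) Real.pi)), rh_vol α h0 h1, ← ENNReal.ofReal_div_of_pos (by positivity)]
  · congr 1; field_simp; ring
  · exact (measurableSet_le (by fun_prop) (by fun_prop)).iff
      (measurableSet_le (by fun_prop) (by fun_prop))
  · measurability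
  · intro r φ hr hφ
    rw [← rh_cos α φ h0 h1 hφ]
    simp only [Set.mem_ofPred_eq]
    rw [show r * Real.cos φ * Real.cos α + r * Real.sin φ * Real.sin α = r * Real.cos (φ - α) by
        rw [Real.cos_sub]; ring,
      show r * Real.cos φ * Real.cos α - r * Real.sin φ * Real.sin α = r * Real.cos (φ + α) by
        rw [Real.cos_add]; ring, mul_nonneg_iff_of_pos_left hr, mul_nonneg_iff_of_pos_left hr]

theorem random_hyperplane_collision_probability {d : ℕ} (hd : 1 ≤ d)
    (x y : Fin d → ℝ) (hx : x ≠ 0) (hy : y ≠ 0) :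
    Measure.pi (fun _ : Fin d => ProbabilityTheory.gaussianReal 0 1)
        {w : Fin d → ℝ | ((0 ≤ ∑ a, w a * x a) ↔ (0 ≤ ∑ a, w a * y a))} =
      ENNReal.ofReal
        (1 - Real.arccos ((∑ a, x a * y a) /
            (Real.sqrt (∑ a, x a ^ 2) * Real.sqrt (∑ a, y a ^ 2))) / Real.pi) := by
  set X : EuclideanSpace ℝ (Fin d) := WithLp.toLp 2 x with hX
  set Y : EuclideanSpace ℝ (Fin d) := WithLp.toLp 2 y with hY
  have hXn : Real.sqrt (∑ a, x a ^ 2) = ‖X‖ := by simp [EuclideanSpace.norm_eq, hX]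
  have hYn : Real.sqrt (∑ a, y a ^ 2) = ‖Y‖ := by simp [EuclideanSpace.norm_eq, hY]
  have hXY : ∑ a, x a * y a = ⟪X, Y⟫ := by simp [PiLp.inner_apply, hX, hY, mul_comm]
  have hX0 : 0 < ‖X‖ := norm_pos_iff.2 (by simpa [hX] using hx)
  have hY0 : 0 < ‖Y‖ := norm_pos_iff.2 (by simpa [hY] using hy)
  rw [hXn, hYn, hXY]
  change _ = ENNReal.ofReal (1 - InnerProductGeometry.angle X Y / Real.pi)
  set θ := InnerProductGeometry.angle X Y with hθ
  have hcos : Real.cos θ * (‖X‖ * ‖Y‖) = ⟪X, Y⟫ := InnerProductGeometry.cos_angle_mul_norm_mul_norm X Y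
  have ht0 : 0 ≤ θ := InnerProductGeometry.angle_nonneg X Y
  have ht1 : θ ≤ Real.pi := InnerProductGeometry.angle_le_pi X Y
  rw [show θ / Real.pi = 2 * (θ / 2) / Real.pi by ring, ← rh_plane (θ/2) (by linarith) (by linarith)]
  set T : Set (ℝ × ℝ) := {p | 0 ≤ p.1 ↔ 0 ≤ p.2} with hT
  have hTm : MeasurableSet T := (measurableSet_le (by fun_prop) (by fun_prop)).iff
      (measurableSet_le (by fun_prop) (by fun_prop))
  set U : EuclideanSpace ℝ (Fin 2) :=
    WithLp.toLp 2 ![‖X‖ * Real.cos (θ/2), ‖X‖ * Real.sin (θ/2)] with hU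
  set V : EuclideanSpace ℝ (Fin 2) :=
    WithLp.toLp 2 ![‖Y‖ * Real.cos (θ/2), -(‖Y‖ * Real.sin (θ/2))] with hV
  have hsc := Real.sin_sq_add_cos_sq (θ/2)
  have hUn : ‖X‖ = ‖U‖ := by
    rw [← sq_eq_sq₀ (norm_nonneg _) (norm_nonneg _), EuclideanSpace.real_norm_sq_eq U]
    simp only [hU, Fin.sum_univ_two, Matrix.cons_val_zero, Matrix.cons_val_one]
    linear_combination (-‖X‖^2) * hsc
  have hVn : ‖Y‖ = ‖V‖ := by
    rw [← sq_eq_sq₀ (norm_nonneg _) (norm_nonneg _), EuclideanSpace.real_norm_sq_eq V]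
    simp only [hV, Fin.sum_univ_two, Matrix.cons_val_zero, Matrix.cons_val_one]
    linear_combination (-‖Y‖^2) * hsc
  have hUV : ⟪X, Y⟫ = ⟪U, V⟫ := by
    have h2 : Real.cos θ = Real.cos (θ/2)^2 - Real.sin (θ/2)^2 := by
      rw [← Real.cos_two_mul']; congr 1; ring
    rw [← hcos, h2]
    simp [hU, hV, PiLp.inner_apply, Fin.sum_univ_two]
    ring
  have key := congrArg (fun m => m T) (rh_map_eq X Y U V hUn hVn hUV)
  simp only at key
  rw [← map_pi_eq_stdGaussian, ← map_pi_eq_stdGaussian, Measure.map_map (by fun_prop) (by fun_prop),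
    Measure.map_map (by fun_prop) (by fun_prop), Measure.map_apply (by fun_prop) hTm,
    Measure.map_apply (by fun_prop) hTm] at key
  convert key using 1
  · congr 1
  · have mp := measurePreserving_finTwoArrow (gaussianReal 0 1)
    rw [← mp.measure_preimage_equiv]
    congr 1
    ext w
    simp only [hT, rhPair, hU, hV, Set.mem_preimage, Set.mem_ofPred_eq, Function.comp]
    simp [PiLp.inner_apply, Fin.sum_univ_two]
    rw [show w 0 * (‖X‖ * Real.cos (θ/2)) + w 1 * (‖X‖ * Real.sin (θ/2)) =
      ‖X‖ * (w 0 * Real.cos (θ/2) + w 1 * Real.sin (θ/2)) by ring,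
      mul_nonneg_iff_of_pos_left hX0, mul_left_comm (w 1), mul_left_comm (w 0),
      mul_le_mul_iff_right₀ hY0]
end
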